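/- arXiv:2511.22605 — 4 statements merged into one kernel-verified Lean document; each statement's English description precedes it below -/
import Mathlib

section
/- Lacunary trigonometric series: for every 1 < p < ∞ there exist constants c_p > 0 and C_p > 0 such that for every finitely supported sequence (a_j)_{j≥0} of complex numbers, the trigonometric polynomial f(x) = Σ_{j≥0} a_j e^{2πi 2^j x} satisfies c_p (Σ_{j≥0} |a_j|²)^{1/2} ≤ ‖f‖_{L^p(𝕋)} ≤ C_p (Σ_{j≥0} |a_j|²)^{1/2}. -/
/- Lacunary trigonometric series: for every 1 < p < ∞ there are constants c_p, C_p > 0 such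
that for every finitely supported sequence (a_j) of complex numbers, the trigonometric
polynomial f(x) = Σ_j a_j e^{2πi 2^j x} satisfies
c_p (Σ_j |a_j|²)^{1/2} ≤ ‖f‖_{L^p(𝕋)} ≤ C_p (Σ_j |a_j|²)^{1/2}. -/

open MeasureTheory

/-- The number of representations of `n` as an ordered sum of `k` powers of two is bounded
uniformly in `n`. -/
theorem exists_card_sum_two_pow_eq_le (k : ℕ) :
    ∃ N : ℕ, ∀ (F : Finset ℕ) (n : ℕ),
      ((Fintype.piFinset fun _ : Fin k => F).filter fun t => ∑ i, 2 ^ t i = n).card ≤ N := by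
  induction k with
  | zero =>
    refine ⟨1, fun F n => (Finset.card_le_univ _).trans ?_⟩
    simp
  | succ k ih =>
    obtain ⟨N, hN⟩ := ih
    refine ⟨(k + 1) * ((k + 2) * N), fun F n => ?_⟩
    let S : Finset (Fin (k + 1) → ℕ) := Finset.univ.biUnion fun i : Fin (k + 1) =>
      (Finset.Icc (Nat.log 2 n - (k + 1)) (Nat.log 2 n)).biUnion fun m =>
        ((Fintype.piFinset fun _ : Fin k => F).filter fun t => ∑ i, 2 ^ t i = n - 2 ^ m).image
          fun t => i.insertNth (α := fun _ => ℕ) m t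
    have hS : (Fintype.piFinset fun _ : Fin (k + 1) => F).filter (fun t => ∑ i, 2 ^ t i = n)
        ⊆ S := by
      intro t ht
      simp only [Finset.mem_filter, Fintype.mem_piFinset] at ht
      obtain ⟨htF, hsum⟩ := ht
      obtain ⟨i, -, hi⟩ := Finset.exists_max_image Finset.univ t Finset.univ_nonempty
      have hle : 2 ^ t i ≤ n := hsum ▸ Finset.single_le_sum (f := fun i => 2 ^ t i)
        (fun _ _ => Nat.zero_le _) (Finset.mem_univ i)
      have hn : n ≠ 0 := fun h => by simp [h] at hle
      have hge : n ≤ (k + 1) * 2 ^ t i := by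
        rw [← hsum]
        refine (Finset.sum_le_card_nsmul _ _ (2 ^ t i) fun j hj =>
          Nat.pow_le_pow_right two_pos (hi j hj)).trans (by simp)
      have hlt : n < 2 ^ (k + 1 + t i) := by
        rw [pow_add]
        exact hge.trans_lt (Nat.mul_lt_mul_of_pos_right Nat.lt_two_pow_self (by positivity))
      have hlog : Nat.log 2 n < k + 1 + t i := Nat.log_lt_of_lt_pow hn hlt
      have hlog' : t i ≤ Nat.log 2 n := Nat.le_log_of_pow_le one_lt_two hle
      simp only [S, Finset.mem_biUnion, Finset.mem_univ, true_and, Finset.mem_Icc,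
        Finset.mem_image, Finset.mem_filter, Fintype.mem_piFinset]
      refine ⟨i, t i, ⟨by omega, hlog'⟩, i.removeNth t, ⟨fun j => htF _, ?_⟩,
        Fin.insertNth_self_removeNth i t⟩
      rw [Fin.sum_univ_succAbove _ i] at hsum
      simp only [Fin.removeNth]
      omega
    refine (Finset.card_le_card hS).trans ?_
    refine (Finset.card_biUnion_le_card_mul _ _ ((k + 2) * N) fun i _ => ?_).trans (by simp)
    refine (Finset.card_biUnion_le_card_mul _ _ N fun m _ =>
      Finset.card_image_le.trans (hN F _)).trans ?_
    refine Nat.mul_le_mul_right _ ?_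
    rw [Nat.card_Icc]
    omega

theorem integral_fourier {T : ℝ} [Fact (0 < T)] (n : ℤ) :
    ∫ x : AddCircle T, fourier n x ∂AddCircle.haarAddCircle = if n = 0 then 1 else 0 := by
  have h := congrFun (fourierCoeff_fourier (T := T) n) 0
  simpa [fourierCoeff, Pi.single_apply, eq_comm] using h

/-- Parseval's identity for a trigonometric polynomial whose frequencies may repeat. -/
theorem integral_norm_sq_sum_mul_fourier {T : ℝ} [Fact (0 < T)] {ι : Type*} (s : Finset ι)
    (c : ι → ℂ) (φ : ι → ℤ) :
    ∫ x : AddCircle T, ‖∑ i ∈ s, c i * fourier (φ i) x‖ ^ 2 ∂AddCircle.haarAddCircle =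
      ∑ i ∈ s, ∑ j ∈ s, if φ i = φ j then (c i * starRingEnd ℂ (c j)).re else 0 := by
  have key (x : AddCircle T) : ((‖∑ i ∈ s, c i * fourier (φ i) x‖ ^ 2 : ℝ) : ℂ) =
      ∑ i ∈ s, ∑ j ∈ s, (c i * starRingEnd ℂ (c j)) * fourier (φ i - φ j) x := by
    rw [Complex.ofReal_pow, ← Complex.mul_conj', map_sum, Finset.sum_mul_sum]
    refine Finset.sum_congr rfl fun i _ => Finset.sum_congr rfl fun j _ => ?_
    rw [sub_eq_add_neg, fourier_add, fourier_neg, map_mul]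
    ring
  have hint (c : ℂ) (n : ℤ) : Integrable (fun x : AddCircle T => c * fourier n x)
      AddCircle.haarAddCircle :=
    (continuous_const.mul (fourier n).continuous).integrable_of_hasCompactSupport
      (HasCompactSupport.of_compactSpace _)
  have h : ((∫ x : AddCircle T, ‖∑ i ∈ s, c i * fourier (φ i) x‖ ^ 2
      ∂AddCircle.haarAddCircle : ℝ) : ℂ) =
      ∑ i ∈ s, ∑ j ∈ s, if φ i = φ j then c i * starRingEnd ℂ (c j) else 0 := by
    rw [← integral_complex_ofReal]
    simp_rw [key]
    rw [integral_finsetSum _ fun i _ => integrable_finsetSum _ fun j _ => hint _ _]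
    simp_rw [integral_finsetSum _ fun j _ => hint _ _, integral_const_mul, integral_fourier,
      sub_eq_zero, mul_ite, mul_one, mul_zero]
  rw [← Complex.ofReal_re (∫ x : AddCircle T, _ ∂_), h]
  simp only [Complex.re_sum, apply_ite Complex.re, Complex.zero_re]

theorem integral_norm_sq_sum_mul_fourier_le {T : ℝ} [Fact (0 < T)] {ι : Type*} (s : Finset ι)
    (c : ι → ℂ) (φ : ι → ℤ) (N : ℕ) (hN : ∀ n, (s.filter fun i => φ i = n).card ≤ N) :
    ∫ x : AddCircle T, ‖∑ i ∈ s, c i * fourier (φ i) x‖ ^ 2 ∂AddCircle.haarAddCircle ≤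
      N * ∑ i ∈ s, ‖c i‖ ^ 2 := by
  have hfiber : ∑ i ∈ s, ∑ j ∈ s, (if φ i = φ j then ‖c i‖ ^ 2 else 0) ≤
      N * ∑ i ∈ s, ‖c i‖ ^ 2 := by
    rw [Finset.mul_sum]
    refine Finset.sum_le_sum fun i _ => ?_
    rw [← Finset.sum_filter, Finset.sum_const, nsmul_eq_mul]
    gcongr
    simpa only [eq_comm] using hN (φ i)
  have hsymm : ∑ i ∈ s, ∑ j ∈ s, (if φ i = φ j then ‖c j‖ ^ 2 else 0) =
      ∑ i ∈ s, ∑ j ∈ s, (if φ i = φ j then ‖c i‖ ^ 2 else 0) := by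
    rw [Finset.sum_comm]
    refine Finset.sum_congr rfl fun i _ => Finset.sum_congr rfl fun j _ => ?_
    simp only [eq_comm (a := φ i)]
  have hpt : ∑ i ∈ s, ∑ j ∈ s, (if φ i = φ j then (c i * starRingEnd ℂ (c j)).re else 0) ≤
      ∑ i ∈ s, ∑ j ∈ s, ((if φ i = φ j then ‖c i‖ ^ 2 else 0) / 2 +
        (if φ i = φ j then ‖c j‖ ^ 2 else 0) / 2) := by
    refine Finset.sum_le_sum fun i _ => Finset.sum_le_sum fun j _ => ?_
    split_ifs
    · have h := Complex.re_le_norm (c i * starRingEnd ℂ (c j))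
      rw [norm_mul, RCLike.norm_conj] at h
      nlinarith [sq_nonneg (‖c i‖ - ‖c j‖)]
    · simp
  simp only [Finset.sum_add_distrib, ← Finset.sum_div] at hpt
  rw [integral_norm_sq_sum_mul_fourier]
  linarith

theorem integral_norm_sq_sum_mul_fourier_of_injOn {T : ℝ} [Fact (0 < T)] {ι : Type*}
    (s : Finset ι) (c : ι → ℂ) (φ : ι → ℤ) (hφ : Set.InjOn φ s) :
    ∫ x : AddCircle T, ‖∑ i ∈ s, c i * fourier (φ i) x‖ ^ 2 ∂AddCircle.haarAddCircle =
      ∑ i ∈ s, ‖c i‖ ^ 2 := by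
  rw [integral_norm_sq_sum_mul_fourier]
  refine Finset.sum_congr rfl fun i hi => ?_
  rw [Finset.sum_eq_single_of_mem i hi fun j hj hji => if_neg fun h => hji (hφ hj hi h.symm),
    if_pos rfl, Complex.mul_conj', ← Complex.ofReal_pow, Complex.ofReal_re]

theorem fourier_sum {T : ℝ} {ι : Type*} (s : Finset ι) (φ : ι → ℤ) (x : AddCircle T) :
    fourier (∑ i ∈ s, φ i) x = ∏ i ∈ s, fourier (φ i) x := by
  classical
  induction s using Finset.induction_on with
  | empty => simp
  | insert i s hi ih => rw [Finset.sum_insert hi, Finset.prod_insert hi, fourier_add, ih]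

/-- Even moments of lacunary trigonometric polynomials are controlled by the `ℓ²` norm of the
coefficients. -/
theorem exists_integral_norm_lacunary_pow_le (k : ℕ) :
    ∃ N : ℕ, 1 ≤ N ∧ ∀ (T : ℝ) [Fact (0 < T)] (F : Finset ℕ) (a : ℕ → ℂ),
      ∫ x : AddCircle T, ‖∑ j ∈ F, a j * fourier ((2 : ℤ) ^ j) x‖ ^ (2 * k)
        ∂AddCircle.haarAddCircle ≤ N * (∑ j ∈ F, ‖a j‖ ^ 2) ^ k := by
  obtain ⟨N, hN⟩ := exists_card_sum_two_pow_eq_le k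
  refine ⟨max N 1, le_max_right _ _, fun T _ F a => ?_⟩
  have hpow (x : AddCircle T) : ‖∑ j ∈ F, a j * fourier ((2 : ℤ) ^ j) x‖ ^ (2 * k) =
      ‖∑ t ∈ Fintype.piFinset fun _ : Fin k => F,
        (∏ i, a (t i)) * fourier (∑ i, (2 : ℤ) ^ t i) x‖ ^ 2 := by
    rw [mul_comm, pow_mul, ← norm_pow, ← Fin.prod_const k (Finset.sum _ _), Finset.prod_univ_sum]
    simp_rw [fourier_sum, Finset.prod_mul_distrib]
  have hcoef : ∑ t ∈ Fintype.piFinset fun _ : Fin k => F, ‖∏ i, a (t i)‖ ^ 2 =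
      (∑ j ∈ F, ‖a j‖ ^ 2) ^ k := by
    rw [← Fin.prod_const, Finset.prod_univ_sum]
    simp_rw [norm_prod, Finset.prod_pow]
  rw [← hcoef]
  simp_rw [hpow]
  refine integral_norm_sq_sum_mul_fourier_le (T := T) _ _
    (fun t : Fin k → ℕ => ∑ i, (2 : ℤ) ^ t i) _ fun n => le_max_of_le_left ?_
  refine (Finset.card_le_card ?_).trans (hN F n.toNat)
  refine Finset.monotone_filter_right _ fun t _ ht => ?_
  have h : ((∑ i, 2 ^ t i : ℕ) : ℤ) = n := by simpa using ht
  omega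

theorem exists_eLpNorm_lacunary_le (p : ENNReal) (hp : p ≠ ⊤) :
    ∃ C : ℝ, 0 < C ∧ ∀ (T : ℝ) [Fact (0 < T)] (F : Finset ℕ) (a : ℕ → ℂ),
      eLpNorm (fun x : AddCircle T => ∑ j ∈ F, a j * fourier ((2 : ℤ) ^ j) x) p
        AddCircle.haarAddCircle ≤ ENNReal.ofReal (C * Real.sqrt (∑ j ∈ F, ‖a j‖ ^ 2)) := by
  obtain ⟨k, hk⟩ := ENNReal.exists_nat_gt hp
  have hk0 : k ≠ 0 := by rintro rfl; simp at hk
  obtain ⟨N, hN1, hN⟩ := exists_integral_norm_lacunary_pow_le k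
  refine ⟨N, by exact_mod_cast hN1, fun T _ F a => ?_⟩
  have hcont : Continuous fun x : AddCircle T => ∑ j ∈ F, a j * fourier ((2 : ℤ) ^ j) x := by
    fun_prop
  have hpk : p ≤ ((2 * k : ℕ) : ENNReal) :=
    hk.le.trans (by exact_mod_cast Nat.le_mul_of_pos_left k two_pos)
  refine (eLpNorm_le_eLpNorm_of_exponent_le hpk hcont.aestronglyMeasurable).trans ?_
  rw [MemLp.eLpNorm_eq_integral_rpow_norm (by simpa using hk0) (ENNReal.natCast_ne_top _)
    (hcont.memLp_of_hasCompactSupport (HasCompactSupport.of_compactSpace _)),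
    ENNReal.toReal_natCast]
  simp_rw [Real.rpow_natCast]
  refine ENNReal.ofReal_le_ofReal ?_
  have hS : 0 ≤ ∑ j ∈ F, ‖a j‖ ^ 2 := Finset.sum_nonneg fun _ _ => sq_nonneg _
  have hle : ∫ x : AddCircle T, ‖∑ j ∈ F, a j * fourier ((2 : ℤ) ^ j) x‖ ^ (2 * k)
      ∂AddCircle.haarAddCircle ≤ (N * Real.sqrt (∑ j ∈ F, ‖a j‖ ^ 2)) ^ (2 * k) := by
    refine (hN T F a).trans ?_
    rw [mul_pow, pow_mul (Real.sqrt _), Real.sq_sqrt hS]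
    gcongr
    exact le_self_pow₀ (by exact_mod_cast hN1) (by simpa using hk0)
  refine (Real.rpow_le_rpow (by positivity) hle (by positivity)).trans_eq ?_
  exact Real.pow_rpow_inv_natCast (by positivity) (by simpa using hk0)

/-- The `L¹` norm of a lacunary trigonometric polynomial controls the `ℓ²` norm of its
coefficients. -/
theorem exists_le_integral_norm_lacunary :
    ∃ c : ℝ, 0 < c ∧ ∀ (T : ℝ) [Fact (0 < T)] (F : Finset ℕ) (a : ℕ → ℂ),
      c * Real.sqrt (∑ j ∈ F, ‖a j‖ ^ 2) ≤
        ∫ x : AddCircle T, ‖∑ j ∈ F, a j * fourier ((2 : ℤ) ^ j) x‖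
          ∂AddCircle.haarAddCircle := by
  obtain ⟨N, hN1, hN⟩ := exists_integral_norm_lacunary_pow_le 2
  have hN0 : (1 : ℝ) ≤ N := by exact_mod_cast hN1
  refine ⟨1 / (4 * N), by positivity, fun T _ F a => ?_⟩
  obtain ⟨S, hS⟩ : ∃ S, Real.sqrt (∑ j ∈ F, ‖a j‖ ^ 2) = S := ⟨_, rfl⟩
  have hS2 : ∑ j ∈ F, ‖a j‖ ^ 2 = S ^ 2 := by
    rw [← hS, Real.sq_sqrt (Finset.sum_nonneg fun _ _ => sq_nonneg _)]
  have h2 := integral_norm_sq_sum_mul_fourier_of_injOn (T := T) F a (fun j => (2 : ℤ) ^ j)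
    (pow_right_injective₀ two_pos (by norm_num)).injOn
  have h4 := hN T F a
  have hcont : Continuous fun x : AddCircle T => ∑ j ∈ F, a j * fourier ((2 : ℤ) ^ j) x := by
    fun_prop
  obtain ⟨f, hf⟩ : ∃ f : AddCircle T → ℂ,
    (fun x => ∑ j ∈ F, a j * fourier ((2 : ℤ) ^ j) x) = f := ⟨_, rfl⟩
  rw [hf] at hcont
  replace hf := congrFun hf
  rw [hS]
  simp only [hS2, hf] at h2 h4 ⊢
  norm_num at h4
  rcases (hS ▸ Real.sqrt_nonneg _ : 0 ≤ S).eq_or_lt with rfl | hSpos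
  · rw [mul_zero]
    exact integral_nonneg fun _ => norm_nonneg _
  have hint (n : ℕ) : Integrable (fun x => ‖f x‖ ^ n) AddCircle.haarAddCircle :=
    (hcont.norm.pow n).integrable_of_hasCompactSupport (HasCompactSupport.of_compactSpace _)
  have hint1 : Integrable (fun x => ‖f x‖) AddCircle.haarAddCircle := by simpa using hint 1
  obtain ⟨A, hA⟩ : ∃ A, 2 * N * S = A := ⟨_, rfl⟩
  have hApos : 0 < A := hA ▸ by positivity
  have hpt (x : AddCircle T) : ‖f x‖ ^ 2 ≤ A * ‖f x‖ + (A ^ 2)⁻¹ * ‖f x‖ ^ 4 := by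
    rcases le_total ‖f x‖ A with h | h
    · have : 0 ≤ (A ^ 2)⁻¹ * ‖f x‖ ^ 4 := by positivity
      nlinarith [norm_nonneg (f x)]
    · have h1 : 1 ≤ (A ^ 2)⁻¹ * ‖f x‖ ^ 2 := by
        rw [inv_mul_eq_div, one_le_div (by positivity)]
        gcongr
      have : 0 ≤ A * ‖f x‖ := by positivity
      nlinarith [sq_nonneg ‖f x‖]
  have hmono := integral_mono (hint 2) ((hint1.const_mul A).add ((hint 4).const_mul (A ^ 2)⁻¹)) hpt
  simp only [Pi.add_apply] at hmono
  rw [integral_add (hint1.const_mul A) ((hint 4).const_mul _), integral_const_mul,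
    integral_const_mul, h2] at hmono
  have h4' : (A ^ 2)⁻¹ * ∫ x, ‖f x‖ ^ 4 ∂AddCircle.haarAddCircle ≤ S ^ 2 / 2 := by
    rw [inv_mul_le_iff₀ (by positivity)]
    refine h4.trans ?_
    rw [← hA]
    have : (N : ℝ) ≤ N ^ 2 := le_self_pow₀ hN0 two_ne_zero
    have : (N : ℝ) * S ^ 4 ≤ N ^ 2 * S ^ 4 := by gcongr
    nlinarith [show 0 ≤ (N : ℝ) ^ 2 * S ^ 4 by positivity]
  rw [one_div, inv_mul_le_iff₀ (by positivity)]
  refine le_of_mul_le_mul_left ?_ hSpos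
  rw [← hA] at hmono h4'
  linarith

theorem lacunary_trigonometric_series (p : ℝ) (hp : 1 < p) :
    ∃ c C : ℝ, 0 < c ∧ 0 < C ∧
      ∀ (F : Finset ℕ) (a : ℕ → ℂ),
        ENNReal.ofReal (c * Real.sqrt (∑ j ∈ F, ‖a j‖ ^ 2)) ≤
            eLpNorm (fun x : AddCircle (1 : ℝ) => ∑ j ∈ F, a j * fourier ((2 : ℤ) ^ j) x)
              (ENNReal.ofReal p) AddCircle.haarAddCircle ∧
          eLpNorm (fun x : AddCircle (1 : ℝ) => ∑ j ∈ F, a j * fourier ((2 : ℤ) ^ j) x)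
              (ENNReal.ofReal p) AddCircle.haarAddCircle ≤
            ENNReal.ofReal (C * Real.sqrt (∑ j ∈ F, ‖a j‖ ^ 2)) := by
  obtain ⟨c, hc, hlower⟩ := exists_le_integral_norm_lacunary
  obtain ⟨C, hC, hupper⟩ := exists_eLpNorm_lacunary_le (ENNReal.ofReal p) ENNReal.ofReal_ne_top
  refine ⟨c, C, hc, hC, fun F a => ⟨?_, hupper 1 F a⟩⟩
  have hcont : Continuous fun x : AddCircle (1 : ℝ) =>
      ∑ j ∈ F, a j * fourier ((2 : ℤ) ^ j) x := by
    fun_prop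
  refine (ENNReal.ofReal_le_ofReal (hlower 1 F a)).trans ?_
  rw [ofReal_integral_norm_eq_lintegral_enorm
    (hcont.integrable_of_hasCompactSupport (HasCompactSupport.of_compactSpace _)),
    ← eLpNorm_one_eq_lintegral_enorm]
  exact eLpNorm_le_eLpNorm_of_exponent_le (by simpa using hp.le) hcont.aestronglyMeasurable
end

section
/- Cotlar–Stein almost-orthogonality lemma: let H be a complex Hilbert space and let (T_j)_{j∈ℤ} be bounded linear operators on H. Suppose there are constants A > 0 and ε > 0 such that for all j, k ∈ ℤ, ‖T_j T_k^*‖ ≤ A · 2^{−ε|j−k|} and ‖T_j^* T_k‖ ≤ A · 2^{−ε|j−k|}. Then there is a constant C, depending only on A and ε, such that ‖ Σ_{j∈F} T_j ‖ ≤ C for every finite subset F ⊆ ℤ; moreover, for every x ∈ H the sums Σ_{|j|≤J} T_j x converge in H as J → ∞, and the limiting operator T satisfies ‖T‖ ≤ C. -/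
/- Cotlar–Stein almost-orthogonality lemma: if (T_j)_{j∈ℤ} are bounded operators on a complex
Hilbert space H with ‖T_j T_k^*‖, ‖T_j^* T_k‖ ≤ A·2^{-ε|j-k|}, then there is C = C(A, ε) with
‖Σ_{j∈F} T_j‖ ≤ C for all finite F ⊆ ℤ; moreover the sums Σ_{|j|≤J} T_j x converge for every
x ∈ H and the limiting operator T satisfies ‖T‖ ≤ C. -/

open Filter ContinuousLinearMap

theorem norm_le_sum_sqrt_norm_adjoint_comp {ι H : Type*} [NormedAddCommGroup H]
    [InnerProductSpace ℂ H] [CompleteSpace H] (T : ι → H →L[ℂ] H) (F : Finset ι) {k : ι}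
    (hk : k ∈ F) : ‖T k‖ ≤ ∑ j ∈ F, √‖adjoint (T j) ∘L T k‖ :=
  calc ‖T k‖ = √‖adjoint (T k) ∘L T k‖ := by
        rw [norm_adjoint_comp_self, Real.sqrt_mul_self (norm_nonneg _)]
    _ ≤ _ := Finset.single_le_sum (f := fun j ↦ √‖adjoint (T j) ∘L T k‖)
        (fun _ _ ↦ Real.sqrt_nonneg _) hk

/-- Iterating `S` and its adjoint on a vector of the form `T k z` costs a factor `M` each time. -/
theorem norm_mul_adjoint_pow_apply_le {ι H : Type*} [NormedAddCommGroup H]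
    [InnerProductSpace ℂ H] [CompleteSpace H] (T : ι → H →L[ℂ] H) (F : Finset ι) {M : ℝ}
    (h₁ : ∀ k ∈ F, ∑ j ∈ F, √‖T j ∘L adjoint (T k)‖ ≤ M)
    (h₂ : ∀ k ∈ F, ∑ j ∈ F, √‖adjoint (T j) ∘L T k‖ ≤ M) (n : ℕ) {k : ι} (hk : k ∈ F) (z : H) :
    ‖(((∑ j ∈ F, T j) * adjoint (∑ j ∈ F, T j)) ^ n) (T k z)‖ ≤
      √M * M ^ (2 * n) * √(‖T k z‖ * ‖z‖) := by
  have hM : 0 ≤ M := (Finset.sum_nonneg fun _ _ ↦ Real.sqrt_nonneg _).trans (h₁ k hk)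
  -- one application of a family `B` to a vector `D z`
  have step (B : ι → H →L[ℂ] H) (Y : H →L[ℂ] H) (D : H →L[ℂ] H) (c : ℝ) (hc : 0 ≤ c)
      (hY : ∀ j ∈ F, ∀ z, ‖Y (B j z)‖ ≤ c * √(‖B j z‖ * ‖z‖))
      (hB : ∑ j ∈ F, √‖B j ∘L D‖ ≤ M) (z : H) :
      ‖Y ((∑ j ∈ F, B j) (D z))‖ ≤ c * M * √(‖D z‖ * ‖z‖) := by
    rw [sum_apply, map_sum]
    calc ‖∑ j ∈ F, Y (B j (D z))‖
        ≤ ∑ j ∈ F, c * (√‖B j ∘L D‖ * √(‖D z‖ * ‖z‖)) := by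
          refine norm_sum_le_of_le _ fun j hj ↦ (hY j hj (D z)).trans ?_
          rw [← Real.sqrt_mul (norm_nonneg _)]
          refine mul_le_mul_of_nonneg_left (Real.sqrt_le_sqrt ?_) hc
          calc ‖B j (D z)‖ * ‖D z‖ ≤ ‖B j ∘L D‖ * ‖z‖ * ‖D z‖ := by
                gcongr; exact (B j ∘L D).le_opNorm z
            _ = _ := by ring
      _ = c * (∑ j ∈ F, √‖B j ∘L D‖) * √(‖D z‖ * ‖z‖) := by
          rw [← Finset.mul_sum, ← Finset.sum_mul, mul_assoc]
      _ ≤ _ := by gcongr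
  induction n generalizing k z with
  | zero =>
    have : ‖T k z‖ ≤ M * ‖z‖ :=
      (T k).le_of_opNorm_le ((norm_le_sum_sqrt_norm_adjoint_comp T F hk).trans (h₂ k hk)) z
    simp only [pow_zero, one_apply_eq_self, mul_zero, mul_one]
    rw [← Real.sqrt_mul hM]
    apply Real.le_sqrt_of_sq_le
    rw [sq, mul_left_comm]
    gcongr
  | succ n ih =>
    set S := ∑ j ∈ F, T j with hS
    have hS' : adjoint S = ∑ j ∈ F, adjoint (T j) := by rw [hS, map_sum]
    have := step (fun j ↦ adjoint (T j)) ((S * adjoint S) ^ n * S) (T k) (√M * M ^ (2 * n) * M)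
      (by positivity)
      (fun j hj z ↦ step T ((S * adjoint S) ^ n) (adjoint (T j)) _ (by positivity)
        (fun i hi z ↦ ih hi z) (h₁ j hj) z) (h₂ k hk) z
    rw [← hS'] at this
    rw [pow_succ, show √M * M ^ (2 * (n + 1)) = √M * M ^ (2 * n) * M * M by ring]
    exact this

/-- **Cotlar–Stein lemma**, for finite sums. -/
theorem norm_sum_le_of_almost_orthogonal {ι H : Type*} [NormedAddCommGroup H]
    [InnerProductSpace ℂ H] [CompleteSpace H] (T : ι → H →L[ℂ] H) (F : Finset ι) {M : ℝ}
    (hM : 0 < M) (h₁ : ∀ k ∈ F, ∑ j ∈ F, √‖T j ∘L adjoint (T k)‖ ≤ M)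
    (h₂ : ∀ k ∈ F, ∑ j ∈ F, √‖adjoint (T j) ∘L T k‖ ≤ M) :
    ‖∑ j ∈ F, T j‖ ≤ M := by
  have key := norm_mul_adjoint_pow_apply_le T F h₁ h₂
  set S := ∑ j ∈ F, T j with hS
  have hT (k) (hk : k ∈ F) (z : H) : ‖T k z‖ ≤ M * ‖z‖ :=
    (T k).le_of_opNorm_le ((norm_le_sum_sqrt_norm_adjoint_comp T F hk).trans (h₂ k hk)) z
  have hpow (n : ℕ) : ‖(S * adjoint S) ^ n * S‖ ≤ F.card * (M * M ^ (2 * n)) := by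
    refine opNorm_le_bound _ (by positivity) fun z ↦ ?_
    rw [mul_apply_eq_comp, hS, sum_apply, map_sum]
    calc _ ≤ ∑ _k ∈ F, M * M ^ (2 * n) * ‖z‖ := by
          refine norm_sum_le_of_le _ fun k hk ↦ (key n hk z).trans ?_
          calc _ ≤ √M * M ^ (2 * n) * √(M * ‖z‖ * ‖z‖) := by gcongr; exact hT k hk z
            _ = (√M * √M) * M ^ (2 * n) * ‖z‖ := by
                rw [mul_assoc M, Real.sqrt_mul hM.le, Real.sqrt_mul_self (norm_nonneg _)]; ring
            _ = _ := by rw [Real.mul_self_sqrt hM.le]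
      _ = _ := by simp [mul_assoc]
  have hnorm (m : ℕ) : (‖S‖ ^ 2) ^ 2 ^ m * M ≤ F.card * ‖S‖ * (M ^ 2) ^ 2 ^ m := by
    obtain ⟨n, hn⟩ := Nat.exists_eq_add_one_of_ne_zero (pow_ne_zero m two_ne_zero)
    have h := (IsSelfAdjoint.mul_star_self S).norm_pow_two_pow m
    rw [CStarRing.norm_self_mul_star, ← sq] at h
    rw [← h, hn, pow_succ, ← mul_assoc]
    calc _ ≤ F.card * (M * M ^ (2 * n)) * ‖S‖ * M := by
          gcongr
          refine (norm_mul_le _ _).trans ?_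
          rw [norm_star]
          gcongr
          exact hpow n
      _ = _ := by ring
  by_contra! hlt
  have hq : 1 < (‖S‖ ^ 2) / (M ^ 2) := by
    rw [one_lt_div (by positivity)]
    gcongr
  obtain ⟨m, hm⟩ := pow_unbounded_of_one_lt (F.card * ‖S‖ / M) hq
  have hm' := hm.trans_le (pow_le_pow_right₀ hq.le Nat.lt_two_pow_self.le)
  rw [div_pow, div_lt_div_iff₀ hM (by positivity)] at hm'
  exact absurd (hnorm m) (not_le.2 hm')

theorem summable_apply_of_norm_sum_le {ι H : Type*} [NormedAddCommGroup H]
    [InnerProductSpace ℂ H] [CompleteSpace H] (T : ι → H →L[ℂ] H) {C : ℝ}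
    (hC : ∀ F : Finset ι, ‖∑ j ∈ F, T j‖ ≤ C)
    (hT : ∀ k, Summable fun j ↦ ‖T j ∘L adjoint (T k)‖) (x : H) :
    Summable fun j ↦ T j x := by
  have hC0 : 0 ≤ C := by simpa using hC ∅
  let L : Submodule ℂ H :=
    { carrier := {x | Summable fun j ↦ T j x}
      add_mem' := fun {x y} hx hy ↦ by
        simpa only [Set.mem_ofPred_eq, map_add] using Summable.add hx hy
      zero_mem' := by simpa only [Set.mem_ofPred_eq, map_zero] using summable_zero
      smul_mem' := fun c x hx ↦ by
        simpa only [Set.mem_ofPred_eq, map_smul] using Summable.const_smul c hx }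
  have hLc : IsClosed (L : Set H) := by
    refine isClosed_of_closure_subset fun x hx ↦ ?_
    refine summable_iff_vanishing_norm.2 fun ε hε ↦ ?_
    obtain ⟨y, hy, hxy⟩ := Metric.mem_closure_iff.1 hx (ε / 2 / (C + 1)) (by positivity)
    obtain ⟨s, hs⟩ := summable_iff_vanishing_norm.1 hy (ε / 2) (by positivity)
    refine ⟨s, fun t ht ↦ ?_⟩
    have h1 : ‖(∑ j ∈ t, T j) (x - y)‖ ≤ ε / 2 := by
      rw [dist_eq_norm] at hxy
      calc _ ≤ (C + 1) * (ε / 2 / (C + 1)) :=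
            (∑ j ∈ t, T j).le_of_opNorm_le_of_le ((hC t).trans (by linarith)) hxy.le
        _ = _ := by field_simp
    have h2 : ∑ j ∈ t, T j x = (∑ j ∈ t, T j) (x - y) + ∑ j ∈ t, T j y := by
      simp [sum_apply]
    rw [h2]
    linarith [norm_add_le ((∑ j ∈ t, T j) (x - y)) (∑ j ∈ t, T j y), hs t ht]
  have hrange (k : ι) (y : H) : adjoint (T k) y ∈ L :=
    Summable.of_norm_bounded ((hT k).mul_right ‖y‖)
      fun j ↦ (T j ∘L adjoint (T k)).le_opNorm y
  have hperp : Lᗮ ≤ L := fun x hx ↦ by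
    have (j : ι) : T j x = 0 := by
      rw [← inner_self_eq_zero (𝕜 := ℂ), ← adjoint_inner_left]
      exact hx _ (hrange j _)
    change Summable fun j ↦ T j x
    simp only [this, summable_zero]
  have hbot : Lᗮ = ⊥ :=
    eq_bot_iff.2 ((le_inf hperp le_rfl).trans L.inf_orthogonal_eq_bot.le)
  have : CompleteSpace L := hLc.completeSpace_coe
  have hx : x ∈ L := by rw [Submodule.orthogonal_eq_bot_iff.1 hbot]; trivial
  exact hx

theorem summable_rpow_neg_abs_int {ε : ℝ} (hε : 0 < ε) :
    Summable fun n : ℤ ↦ (2 : ℝ) ^ (-(ε * |(n : ℝ)|)) := by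
  have hr : (2 : ℝ) ^ (-ε) < 1 := Real.rpow_lt_one_of_one_lt_of_neg (by norm_num) (by linarith)
  have hs := summable_geometric_of_lt_one (by positivity) hr
  have : ∀ n : ℕ, (2 : ℝ) ^ (-(ε * n)) = ((2 : ℝ) ^ (-ε)) ^ n := fun n ↦ by
    rw [← Real.rpow_natCast, ← Real.rpow_mul (by norm_num), neg_mul]
  refine Summable.of_nat_of_neg ?_ ?_ <;> simpa [this] using hs

theorem cotlar_stein (A ε : ℝ) (hA : 0 < A) (hε : 0 < ε) :
    ∃ C : ℝ,
      ∀ (H : Type*) [NormedAddCommGroup H] [InnerProductSpace ℂ H] [CompleteSpace H]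
        (T : ℤ → H →L[ℂ] H),
        (∀ j k : ℤ,
          ‖T j ∘L adjoint (T k)‖ ≤ A * (2 : ℝ) ^ (-(ε * |(j : ℝ) - (k : ℝ)|)) ∧
          ‖adjoint (T j) ∘L T k‖ ≤ A * (2 : ℝ) ^ (-(ε * |(j : ℝ) - (k : ℝ)|))) →
        (∀ F : Finset ℤ, ‖∑ j ∈ F, T j‖ ≤ C) ∧
        ∃ S : H →L[ℂ] H, ‖S‖ ≤ C ∧
          ∀ x : H,
            Tendsto (fun J : ℕ => ∑ j ∈ Finset.Icc (-(J : ℤ)) (J : ℤ), T j x)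
              atTop (nhds (S x)) := by
  set g : ℤ → ℝ := fun n ↦ √A * (2 : ℝ) ^ (-(ε / 2 * |(n : ℝ)|)) with hg
  have hg0 (n : ℤ) : 0 < g n := by positivity
  have hgs : Summable g := (summable_rpow_neg_abs_int (half_pos hε)).mul_left _
  have hsq (n : ℤ) : A * (2 : ℝ) ^ (-(ε * |(n : ℝ)|)) = g n ^ 2 := by
    rw [hg, mul_pow, Real.sq_sqrt hA.le, ← Real.rpow_mul_natCast (by norm_num)]
    congr 2
    push_cast
    ring
  have hsum (F : Finset ℤ) (k : ℤ) : ∑ j ∈ F, g (j - k) ≤ ∑' n, g n := by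
    rw [← (Equiv.subRight k).tsum_eq g]
    exact ((Equiv.subRight k).summable_iff.2 hgs).sum_le_tsum F fun _ _ ↦ (hg0 _).le
  have hM : 0 < ∑' n, g n := hgs.tsum_pos (fun n ↦ (hg0 n).le) 0 (hg0 0)
  refine ⟨∑' n, g n, fun H _ _ _ T hT ↦ ?_⟩
  have hT' (j k : ℤ) : ‖T j ∘L adjoint (T k)‖ ≤ g (j - k) ^ 2 ∧
      ‖adjoint (T j) ∘L T k‖ ≤ g (j - k) ^ 2 := by
    rw [← hsq, Int.cast_sub]
    exact hT j k
  have hC (F : Finset ℤ) : ‖∑ j ∈ F, T j‖ ≤ ∑' n, g n :=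
    norm_sum_le_of_almost_orthogonal T F hM
      (fun k _ ↦ (Finset.sum_le_sum fun j _ ↦
        (Real.sqrt_le_left (hg0 _).le).2 (hT' j k).1).trans (hsum F k))
      (fun k _ ↦ (Finset.sum_le_sum fun j _ ↦
        (Real.sqrt_le_left (hg0 _).le).2 (hT' j k).2).trans (hsum F k))
  have hsummable (x : H) : Summable fun j ↦ T j x := by
    refine summable_apply_of_norm_sum_le T hC (fun k ↦ ?_) x
    refine Summable.of_nonneg_of_le (fun _ ↦ norm_nonneg _) (fun j ↦ (hT j k).1) ?_
    simpa [Function.comp_def] using (Equiv.subRight k).summable_iff.2 ((summable_rpow_neg_abs_int hε).mul_left A)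
  have hlim (x : H) : Tendsto (fun J : ℕ ↦ ∑ j ∈ Finset.Icc (-(J : ℤ)) (J : ℤ), T j x)
      atTop (nhds (∑' j, T j x)) :=
    (hsummable x).hasSum.comp Finset.tendsto_Icc_neg
  let S : H →L[ℂ] H := continuousLinearMapOfTendsto
    (fun J : ℕ ↦ ∑ j ∈ Finset.Icc (-(J : ℤ)) (J : ℤ), T j) (f := fun x ↦ ∑' j, T j x)
    (tendsto_pi_nhds.2 fun x ↦ by simpa only [sum_apply] using hlim x)
  refine ⟨hC, S, opNorm_le_bound _ hM.le fun x ↦ ?_, hlim⟩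
  refine le_of_tendsto (hlim x).norm (Eventually.of_forall fun J ↦ ?_)
  rw [← sum_apply]
  exact le_of_opNorm_le _ (hC _) x
end

section
/- Marcinkiewicz–Zygmund vector-valued extension: let (X, μ) and (Y, ν) be measure spaces, let 1 ≤ p < ∞, and let T : L^p(μ) → L^p(ν) be a bounded linear operator (on complex-valued L^p spaces). Then for every N ≥ 1 and every f_1, …, f_N ∈ L^p(μ), ‖ (Σ_{j=1}^N |T f_j|²)^{1/2} ‖_{L^p(ν)} ≤ ‖T‖ · ‖ (Σ_{j=1}^N |f_j|²)^{1/2} ‖_{L^p(μ)}, where ‖T‖ is the operator norm of T. -/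
/- Marcinkiewicz–Zygmund vector-valued extension: a bounded linear operator
T : L^p(μ) → L^p(ν) (1 ≤ p < ∞, complex scalars) satisfies
‖(Σ_{j=1}^N |T f_j|²)^{1/2}‖_{L^p(ν)} ≤ ‖T‖ ‖(Σ_{j=1}^N |f_j|²)^{1/2}‖_{L^p(μ)}. -/

open MeasureTheory

/-- The unitary group of a finite-dimensional space acts transitively on the unit sphere. -/
theorem exists_linearIsometryEquiv_apply_eq {𝕜 E : Type*} [RCLike 𝕜] [NormedAddCommGroup E]
    [InnerProductSpace 𝕜 E] [FiniteDimensional 𝕜 E] {u v : E} (hu : ‖u‖ = 1) (hv : ‖v‖ = 1) :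
    ∃ L : E ≃ₗᵢ[𝕜] E, L u = v := by
  let e := LinearIsometryEquiv.toSpanUnitSingleton (𝕜 := 𝕜) u hu
  let L₀ := (LinearIsometry.toSpanSingleton 𝕜 E hv).comp e.symm.toLinearIsometry
  refine ⟨L₀.extend.toLinearIsometryEquiv rfl, ?_⟩
  have he : (⟨u, Submodule.mem_span_singleton_self u⟩ : Submodule.span 𝕜 {u}) = e 1 := by
    ext
    simp [e]
  have h := L₀.extend_apply ⟨u, Submodule.mem_span_singleton_self u⟩
  simpa [L₀, he] using h

/-- A unitarily invariant measure: the `q`-th absolute moment of `inner w z` in `w` is a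
constant multiple of `‖z‖ ^ q`. -/
theorem exists_measure_lintegral_inner_rpow (N : ℕ) {q : ℝ} (hq : 0 < q) :
    ∃ (ρ : Measure (EuclideanSpace ℂ (Fin N))) (c : ENNReal), SFinite ρ ∧ c ≠ 0 ∧ c ≠ ⊤ ∧
      ∀ z : EuclideanSpace ℂ (Fin N), ∫⁻ w, ‖inner ℂ w z‖ₑ ^ q ∂ρ = c * ‖z‖ₑ ^ q := by
  set ρ : Measure (EuclideanSpace ℂ (Fin N)) :=
    volume.restrict (Metric.ball 0 1) with hρ
  have hρ_map (L : EuclideanSpace ℂ (Fin N) ≃ₗᵢ[ℂ] EuclideanSpace ℂ (Fin N)) :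
      MeasurePreserving L ρ ρ := by
    let L' : EuclideanSpace ℂ (Fin N) ≃ₗᵢ[ℝ] EuclideanSpace ℂ (Fin N) :=
      ⟨L.toLinearEquiv.restrictScalars ℝ, L.norm_map⟩
    have h := L'.measurePreserving.restrict_preimage
      (s := Metric.ball 0 1) measurableSet_ball
    have h_ball : L' ⁻¹' Metric.ball 0 1 = Metric.ball 0 1 := by
      rw [L'.preimage_ball, map_zero]
    rwa [h_ball] at h
  let I (z : EuclideanSpace ℂ (Fin N)) : ENNReal := ∫⁻ w, ‖inner ℂ w z‖ₑ ^ q ∂ρ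
  have hI_map (L : EuclideanSpace ℂ (Fin N) ≃ₗᵢ[ℂ] EuclideanSpace ℂ (Fin N)) (z) :
      I (L z) = I z := by
    have h := (hρ_map L).lintegral_comp (f := fun w => ‖inner ℂ w (L z)‖ₑ ^ q) (by fun_prop)
    simpa [I] using h.symm
  have hI_smul (a : ℂ) (z) : I (a • z) = ‖a‖ₑ ^ q * I z := by
    simp only [I, inner_smul_right, enorm_mul, ENNReal.mul_rpow_of_nonneg _ _ hq.le]
    exact lintegral_const_mul _ (by fun_prop)
  by_cases hE : ∃ e : EuclideanSpace ℂ (Fin N), ‖e‖ = 1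
  · obtain ⟨e, he⟩ := hE
    refine ⟨ρ, I e, inferInstance, ?_, ?_, fun z => ?_⟩
    · rw [← pos_iff_ne_zero, lintegral_pos_iff_support (by fun_prop), hρ]
      have h_open : IsOpen {w : EuclideanSpace ℂ (Fin N) | inner ℂ w e ≠ 0} :=
        isOpen_ne_fun (by fun_prop) continuous_const
      have h_supp : (Function.support fun w : EuclideanSpace ℂ (Fin N) => ‖inner ℂ w e‖ₑ ^ q) =
          {w | inner ℂ w e ≠ 0} := by
        ext w
        simp [hq, hq.not_gt]
      rw [h_supp, Measure.restrict_apply h_open.measurableSet]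
      refine (h_open.inter Metric.isOpen_ball).measure_pos _ ⟨(1 / 2 : ℂ) • e, ?_, ?_⟩
      · simp [he, inner_self_eq_norm_sq_to_K]
      · simp [norm_smul, he]
        norm_num
    · refine ne_top_of_le_ne_top (measure_ball_lt_top (x := 0) (r := 1)).ne
        (b := volume (Metric.ball (0 : EuclideanSpace ℂ (Fin N)) 1)) ?_
      rw [← setLIntegral_one]
      refine setLIntegral_mono measurable_const fun w hw => ?_
      refine ENNReal.rpow_le_one ?_ hq.le
      rw [← ofReal_norm, ENNReal.ofReal_le_one]
      have hw' : ‖w‖ < 1 := by simpa using hw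
      calc ‖inner ℂ w e‖ ≤ ‖w‖ * ‖e‖ := norm_inner_le_norm _ _
        _ ≤ 1 := by rw [he, mul_one]; exact hw'.le
    · change I z = _
      rcases eq_or_ne z 0 with rfl | hz
      · simp [I, hq]
      · obtain ⟨L, hL⟩ := exists_linearIsometryEquiv_apply_eq (𝕜 := ℂ) he
          (norm_smul_inv_norm (𝕜 := ℂ) hz)
        have hz' : z = (‖z‖ : ℂ) • L e := by
          rw [hL, smul_smul]
          simp [hz]
        conv_lhs => rw [hz', hI_smul, hI_map, mul_comm]
        congr 2
        simp [← ofReal_norm]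
  · refine ⟨ρ, 1, inferInstance, one_ne_zero, ENNReal.one_ne_top, fun z => ?_⟩
    have hz : z = 0 := by
      by_contra hz
      exact hE ⟨_, norm_smul_inv_norm (𝕜 := ℂ) hz⟩
    simp [hz, hq]

/-- Averaging the `q`-th power of the `L^p` norm of random linear combinations of functions gives
the `q`-th power of the `L^p` norm of their square function, up to a constant. -/
theorem lintegral_enorm_sum_smul_rpow {X : Type*} [MeasurableSpace X] (μ : Measure X) [SFinite μ]
    (p : ENNReal) [Fact (1 ≤ p)] (hp : p ≠ ⊤) {N : ℕ} {ρ : Measure (EuclideanSpace ℂ (Fin N))}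
    [SFinite ρ] {c : ENNReal} (hc : c ≠ ⊤)
    (hρ : ∀ z : EuclideanSpace ℂ (Fin N),
      ∫⁻ w, ‖inner ℂ w z‖ₑ ^ p.toReal ∂ρ = c * ‖z‖ₑ ^ p.toReal)
    (f : Fin N → Lp ℂ p μ) :
    ∫⁻ w, ‖∑ j, starRingEnd ℂ (w j) • f j‖ₑ ^ p.toReal ∂ρ =
      c * eLpNorm (fun x => Real.sqrt (∑ j, ‖(f j : X → ℂ) x‖ ^ 2)) p μ ^ p.toReal := by
  have hp₀ : p ≠ 0 := (zero_lt_one.trans_le Fact.out).ne'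
  have hq : 0 < p.toReal := ENNReal.toReal_pos hp₀ hp
  have h_meas (j) : Measurable (f j : X → ℂ) := (Lp.stronglyMeasurable (f j)).measurable
  have h_pow {F : Type} [NormedAddCommGroup F] (g : X → F) :
      eLpNorm g p μ ^ p.toReal = ∫⁻ x, ‖g x‖ₑ ^ p.toReal ∂μ := by
    rw [eLpNorm_eq_lintegral_rpow_enorm_toReal hp₀ hp, ← ENNReal.rpow_mul,
      one_div_mul_cancel hq.ne', ENNReal.rpow_one]
  have h_norm (w : EuclideanSpace ℂ (Fin N)) :
      ‖∑ j, starRingEnd ℂ (w j) • f j‖ₑ ^ p.toReal =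
        ∫⁻ x, ‖∑ j, starRingEnd ℂ (w j) * (f j : X → ℂ) x‖ₑ ^ p.toReal ∂μ := by
    rw [Lp.enorm_def, h_pow]
    refine lintegral_congr_ae ?_
    have h_smul : ∀ᵐ x ∂μ, ∀ j, (starRingEnd ℂ (w j) • f j : Lp ℂ p μ) x =
        starRingEnd ℂ (w j) * (f j : X → ℂ) x :=
      ae_all_iff.2 fun j => Lp.coeFn_smul _ _
    have h_sum := Lp.coeFn_finsetSum (Finset.univ) (fun j => starRingEnd ℂ (w j) • f j)
    filter_upwards [h_smul, h_sum] with x hx hx'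
    rw [hx', Finset.sum_apply, Finset.sum_congr rfl fun j _ => hx j]
  simp_rw [h_norm]
  rw [lintegral_lintegral_swap (by fun_prop), h_pow, ← lintegral_const_mul' _ _ hc]
  refine lintegral_congr fun x => ?_
  have h := hρ (WithLp.toLp 2 fun j => (f j : X → ℂ) x)
  have h_inner (w : EuclideanSpace ℂ (Fin N)) :
      inner ℂ w (WithLp.toLp 2 fun j => (f j : X → ℂ) x) =
        ∑ j, starRingEnd ℂ (w j) * (f j : X → ℂ) x := by
    simp [PiLp.inner_apply, mul_comm]
  simp_rw [h_inner] at h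
  rw [h, ← ofReal_norm, ← ofReal_norm (Real.sqrt _), EuclideanSpace.norm_eq,
    Real.norm_of_nonneg (Real.sqrt_nonneg _)]

theorem marcinkiewicz_zygmund_vector_valued
    {X Y : Type*} [MeasurableSpace X] [MeasurableSpace Y]
    (μ : Measure X) (ν : Measure Y) [SigmaFinite μ] [SigmaFinite ν]
    (p : ENNReal) [Fact (1 ≤ p)] (hp : p ≠ ⊤)
    (T : Lp ℂ p μ →L[ℂ] Lp ℂ p ν)
    (N : ℕ) (hN : 1 ≤ N) (f : Fin N → Lp ℂ p μ) :
    eLpNorm (fun y => Real.sqrt (∑ j, ‖(T (f j) : Y → ℂ) y‖ ^ 2)) p ν ≤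
      ENNReal.ofReal ‖T‖ *
        eLpNorm (fun x => Real.sqrt (∑ j, ‖(f j : X → ℂ) x‖ ^ 2)) p μ := by
  have hq : 0 < p.toReal := ENNReal.toReal_pos (zero_lt_one.trans_le Fact.out).ne' hp
  obtain ⟨ρ, c, hρ, hc₀, hc, h⟩ := exists_measure_lintegral_inner_rpow N hq
  rw [← ENNReal.rpow_le_rpow_iff hq, ENNReal.mul_rpow_of_nonneg _ _ hq.le,
    ← ENNReal.mul_le_mul_iff_right hc₀ hc, ← lintegral_enorm_sum_smul_rpow ν p hp hc h,
    mul_left_comm, ← lintegral_enorm_sum_smul_rpow μ p hp hc h,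
    ← lintegral_const_mul' _ _ (ENNReal.rpow_ne_top_of_nonneg hq.le ENNReal.ofReal_ne_top)]
  refine lintegral_mono fun w => ?_
  rw [← ENNReal.mul_rpow_of_nonneg _ _ hq.le, ofReal_norm]
  have h_map : ∑ j, starRingEnd ℂ (w j) • T (f j) = T (∑ j, starRingEnd ℂ (w j) • f j) := by
    simp
  rw [h_map]
  exact ENNReal.rpow_le_rpow (T.le_opENorm _) hq.le
end

section
/- Fefferman's reverse square function inequality at L⁴ in the plane: there is an absolute constant C such that the following holds. For 0 < δ ≤ 1 let N = ⌈2π δ^{−1/2}⌉ and, for 0 ≤ m < N, let τ_m = {ξ ∈ ℝ² : 1 − δ ≤ |ξ| ≤ 1 + δ, 2πm/N ≤ arg ξ < 2π(m+1)/N} be the sectorial pieces of the δ-neighbourhood of the unit circle. Then for every 0 < δ ≤ 1 and every Schwartz function f on ℝ², ‖ Σ_{m=0}^{N−1} Q_{τ_m} f ‖_{L⁴(ℝ²)} ≤ C ‖ (Σ_{m=0}^{N−1} |Q_{τ_m} f|²)^{1/2} ‖_{L⁴(ℝ²)}. -/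
/- Fefferman's reverse square function inequality at L⁴ in the plane: with N = ⌈2πδ^{-1/2}⌉
and τ_m the sectorial pieces of the δ-neighbourhood of the unit circle, one has
‖Σ_{m<N} Q_{τ_m} f‖_{L⁴(ℝ²)} ≤ C ‖(Σ_{m<N} |Q_{τ_m} f|²)^{1/2}‖_{L⁴(ℝ²)}, with C absolute. -/

open MeasureTheory
open scoped FourierTransform

noncomputable section

/-- The angle of a nonzero vector in ℝ², taken in `[0, 2π)` (with junk value `0` at `0`). -/
def argTwoPi (ξ : EuclideanSpace ℝ (Fin 2)) : ℝ :=
  let a := Complex.arg (((ξ 0 : ℝ) : ℂ) + (ξ 1 : ℝ) * Complex.I)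
  if a < 0 then a + 2 * Real.pi else a

/-- The `m`-th sectorial piece of the `δ`-neighbourhood of the unit circle:
`{ξ : 1 - δ ≤ |ξ| ≤ 1 + δ, 2πm/N ≤ arg ξ < 2π(m+1)/N}`. -/
def circleSector (δ : ℝ) (N m : ℕ) : Set (EuclideanSpace ℝ (Fin 2)) :=
  {ξ | 1 - δ ≤ ‖ξ‖ ∧ ‖ξ‖ ≤ 1 + δ ∧
    2 * Real.pi * m / N ≤ argTwoPi ξ ∧ argTwoPi ξ < 2 * Real.pi * (m + 1) / N}

/-- The frequency projection `Q_E f` on ℝ²: the inverse Fourier transform of `χ_E f̂`. -/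
def freqProj2 (E : Set (EuclideanSpace ℝ (Fin 2)))
    (f : EuclideanSpace ℝ (Fin 2) → ℂ) : EuclideanSpace ℝ (Fin 2) → ℂ :=
  𝓕⁻ (E.indicator (𝓕 f))

theorem norm_sum_sq_le_of_almost_orthogonal {ι H : Type*} [NormedAddCommGroup H]
    [InnerProductSpace ℂ H] (P : Finset ι) (h : ι → H) (R : ι → ι → Prop)
    [∀ p, DecidablePred (R p)] (hsymm : ∀ p q, R p q → R q p) (K : ℕ)
    (hK : ∀ p ∈ P, (P.filter (R p)).card ≤ K)
    (horth : ∀ p ∈ P, ∀ q ∈ P, ¬ R p q → inner ℂ (h p) (h q) = 0) :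
    ‖∑ p ∈ P, h p‖ ^ 2 ≤ K * ∑ p ∈ P, ‖h p‖ ^ 2 := by
  have e1 : ‖∑ p ∈ P, h p‖ ^ 2 = ∑ p ∈ P, ∑ q ∈ P, RCLike.re (inner ℂ (h p) (h q)) := by
    rw [← inner_self_eq_norm_sq (𝕜 := ℂ), sum_inner, map_sum]
    simp only [inner_sum, map_sum]
  have e2 : ∀ p ∈ P, ∀ q ∈ P, RCLike.re (inner ℂ (h p) (h q)) ≤
      if R p q then (‖h p‖ ^ 2 + ‖h q‖ ^ 2) / 2 else 0 := by
    intro p hp q hq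
    split_ifs with hR
    · have := re_inner_le_norm (𝕜 := ℂ) (h p) (h q)
      nlinarith [sq_nonneg (‖h p‖ - ‖h q‖)]
    · simp [horth p hp q hq hR]
  have e3 : ∑ p ∈ P, ∑ q ∈ P, (if R p q then ‖h p‖ ^ 2 else 0) ≤ K * ∑ p ∈ P, ‖h p‖ ^ 2 := by
    rw [Finset.mul_sum]
    refine Finset.sum_le_sum fun p hp => ?_
    rw [← Finset.sum_filter, Finset.sum_const, nsmul_eq_mul]
    gcongr
    exact hK p hp
  have e4 : ∑ p ∈ P, ∑ q ∈ P, (if R p q then ‖h q‖ ^ 2 else 0)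
      = ∑ p ∈ P, ∑ q ∈ P, (if R p q then ‖h p‖ ^ 2 else 0) := by
    rw [Finset.sum_comm]
    refine Finset.sum_congr rfl fun p _ => Finset.sum_congr rfl fun q _ => ?_
    simp only [show R q p ↔ R p q from ⟨hsymm _ _, hsymm _ _⟩]
  calc ‖∑ p ∈ P, h p‖ ^ 2
      ≤ ∑ p ∈ P, ∑ q ∈ P, (if R p q then (‖h p‖ ^ 2 + ‖h q‖ ^ 2) / 2 else 0) := by
        rw [e1]
        exact Finset.sum_le_sum fun p hp => Finset.sum_le_sum fun q hq => e2 p hp q hq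
    _ = (∑ p ∈ P, ∑ q ∈ P, (if R p q then ‖h p‖ ^ 2 else 0)
          + ∑ p ∈ P, ∑ q ∈ P, (if R p q then ‖h q‖ ^ 2 else 0)) / 2 := by
        rw [← Finset.sum_add_distrib, Finset.sum_div]
        refine Finset.sum_congr rfl fun p _ => ?_
        rw [← Finset.sum_add_distrib, Finset.sum_div]
        refine Finset.sum_congr rfl fun q _ => ?_
        split_ifs <;> simp
    _ ≤ _ := by rw [e4]; linarith

section
variable {E : Type*} [NormedAddCommGroup E] [InnerProductSpace ℝ E] [FiniteDimensional ℝ E]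
  [MeasurableSpace E] [BorelSpace E]

theorem continuous_fourierInv_of_integrable {u : E → ℂ} (hu : Integrable u) :
    Continuous (𝓕⁻ u) := by
  rw [Real.fourierInv_eq_fourier_comp_neg]
  exact VectorFourier.fourierIntegral_continuous (L := innerₗ E) Real.continuous_fourierChar
    (by exact continuous_inner) hu.comp_neg

theorem integral_smul_fourierInv_eq_flip {φ u : E → ℂ} (hφ : Integrable φ) (hu : Integrable u) :
    ∫ x, φ x • 𝓕⁻ u x = ∫ ξ, 𝓕⁻ φ ξ • u ξ := by
  have hflip : (-innerₗ E).flip = -innerₗ E := by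
    ext x y
    simp [real_inner_comm]
  have h := VectorFourier.integral_fourierIntegral_smul_eq_flip (L := -innerₗ E) (f := φ) (g := u)
    (μ := volume) (ν := volume) Real.continuous_fourierChar
    (by exact (continuous_inner (𝕜 := ℝ) (E := E)).neg) hφ hu
  rw [hflip] at h
  exact h.symm

theorem fourierInv_toLp_ae_eq {u : E → ℂ} (hu : Integrable u) (hu2 : MemLp u 2) :
    (𝓕⁻ (hu2.toLp u) : Lp ℂ 2 (volume : Measure E)) =ᵐ[volume] 𝓕⁻ u := by
  apply ae_eq_of_integral_contDiff_smul_eq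
  · exact (Lp.memLp _).locallyIntegrable (by norm_num)
  · exact (continuous_fourierInv_of_integrable hu).locallyIntegrable
  · intro g g_smooth g_cpt
    have hg₁ : HasCompactSupport (Complex.ofRealCLM ∘ g) := g_cpt.comp_left rfl
    have hg₂ : ContDiff ℝ ((⊤ : ℕ∞) : WithTop ℕ∞) (Complex.ofRealCLM ∘ g) := by fun_prop
    set φ : SchwartzMap E ℂ := hg₁.toSchwartzMap hg₂ with hφ
    have hφa : ∀ x, φ x = g x := fun x => by simp [hφ]
    have h1 : ∫ x, φ x • (𝓕⁻ (hu2.toLp u) : Lp ℂ 2 (volume : Measure E)) x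
        = ∫ x, (𝓕⁻ φ) x • (hu2.toLp u) x := by
      rw [← Lp.toTemperedDistribution_apply, ← Lp.fourierInv_toTemperedDistribution_eq,
        TemperedDistribution.fourierInv_apply, Lp.toTemperedDistribution_apply]
    have h2 : ∫ x, (𝓕⁻ φ) x • (hu2.toLp u) x = ∫ x, 𝓕⁻ (φ : E → ℂ) x • u x := by
      apply integral_congr_ae
      filter_upwards [hu2.coeFn_toLp] with x hx
      rw [hx, SchwartzMap.fourierInv_coe]
    rw [← integral_smul_fourierInv_eq_flip φ.integrable hu] at h2
    simpa [hφa] using h1.trans h2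

theorem memLp_two_fourierInv {u : E → ℂ} (hu : Integrable u) (hu2 : MemLp u 2) :
    MemLp (𝓕⁻ u) 2 :=
  (Lp.memLp _).ae_eq (fourierInv_toLp_ae_eq hu hu2)

theorem toLp_fourierInv_eq {u : E → ℂ} (hu : Integrable u) (hu2 : MemLp u 2) :
    (memLp_two_fourierInv hu hu2).toLp (𝓕⁻ u) = 𝓕⁻ (hu2.toLp u) :=
  Lp.ext ((MemLp.coeFn_toLp _).trans (fourierInv_toLp_ae_eq hu hu2).symm)

theorem inner_toLp_fourierInv_eq {u v : E → ℂ} (hu : Integrable u) (hu2 : MemLp u 2)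
    (hv : Integrable v) (hv2 : MemLp v 2) :
    inner ℂ ((memLp_two_fourierInv hu hu2).toLp (𝓕⁻ u))
      ((memLp_two_fourierInv hv hv2).toLp (𝓕⁻ v)) = inner ℂ (hu2.toLp u) (hv2.toLp v) := by
  rw [toLp_fourierInv_eq hu, toLp_fourierInv_eq hv]
  exact (Lp.fourierTransformₗᵢ E ℂ).symm.inner_map_map _ _

theorem inner_toLp_eq_zero_of_mul_eq_zero {u v : E → ℂ} (hu2 : MemLp u 2) (hv2 : MemLp v 2)
    (h : ∀ ξ, u ξ = 0 ∨ v ξ = 0) : inner ℂ (hu2.toLp u) (hv2.toLp v) = 0 := by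
  rw [L2.inner_def]
  refine integral_eq_zero_of_ae ?_
  filter_upwards [hu2.coeFn_toLp, hv2.coeFn_toLp] with x hx hy
  rw [hx, hy]
  rcases h x with h | h <;> simp [h]

theorem memLp_two_of_integrable_of_bounded {u : E → ℂ} (hu : Integrable u) {B : ℝ}
    (hB : ∀ ξ, ‖u ξ‖ ≤ B) : MemLp u 2 := by
  rw [memLp_two_iff_integrable_sq_norm hu.1]
  simp only [sq]
  exact hu.norm.bdd_mul hu.1.norm (c := B) (by simpa using .of_forall hB)

open Convolution ContinuousLinearMap

theorem fourierInv_mul_convolution_eq {u v : E → ℂ} (hu : Integrable u) (hv : Integrable v)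
    (x : E) : 𝓕⁻ (u ⋆[mul ℂ ℂ] v) x = 𝓕⁻ u x * 𝓕⁻ v x := by
  simp only [Real.fourierInv_eq_fourier_neg, Real.fourier_mul_convolution_eq hu hv]

theorem norm_convolution_le {u v : E → ℂ} (hu : Integrable u) {B : ℝ}
    (hB : ∀ ξ, ‖v ξ‖ ≤ B) (ζ : E) : ‖(u ⋆[mul ℂ ℂ] v) ζ‖ ≤ (∫ ξ, ‖u ξ‖) * B := by
  rw [convolution_def, ← integral_mul_const]
  refine norm_integral_le_of_norm_le (hu.norm.mul_const B) (.of_forall fun ξ => ?_)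
  simp only [mul_apply', norm_mul]
  gcongr
  exact hB _

theorem exists_of_convolution_ne_zero {u v : E → ℂ} {ζ : E} (h : (u ⋆[mul ℂ ℂ] v) ζ ≠ 0) :
    ∃ ξ η, u ξ ≠ 0 ∧ v η ≠ 0 ∧ ξ + η = ζ := by
  contrapose! h
  rw [convolution_def]
  refine integral_eq_zero_of_ae (.of_forall fun ξ => ?_)
  by_cases h1 : u ξ = 0
  · simp [h1]
  by_cases h2 : v (ζ - ξ) = 0
  · simp [h2]
  exact absurd (by abel) (h ξ (ζ - ξ) h1 h2)

/-- If only boundedly many of the sumsets of supports `supp (u i) + supp (u j)` meet a given one, the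
reverse square function estimate holds in `L⁴`. -/
theorem integral_norm_sum_fourierInv_pow_four_le {ι : Type*} (M : Finset ι) (u : ι → E → ℂ)
    (hu : ∀ i, Integrable (u i)) (hB : ∀ i, ∃ B, ∀ ξ, ‖u i ξ‖ ≤ B) (R : ι × ι → ι × ι → Prop)
    [∀ p, DecidablePred (R p)] (hsymm : ∀ p q, R p q → R q p)
    (hR : ∀ p ∈ M ×ˢ M, ∀ q ∈ M ×ˢ M, ∀ ξ η ξ' η', u p.1 ξ ≠ 0 → u p.2 η ≠ 0 → u q.1 ξ' ≠ 0 →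
      u q.2 η' ≠ 0 → ξ + η = ξ' + η' → R p q) (K : ℕ)
    (hK : ∀ p ∈ M ×ˢ M, ((M ×ˢ M).filter (R p)).card ≤ K) :
    ∫ x, ‖∑ i ∈ M, 𝓕⁻ (u i) x‖ ^ 4 ≤ K * ∫ x, (∑ i ∈ M, ‖𝓕⁻ (u i) x‖ ^ 2) ^ 2 := by
  set W : ι × ι → E → ℂ := fun p => u p.1 ⋆[mul ℂ ℂ] u p.2
  have hW1 : ∀ p, Integrable (W p) := fun p => (hu p.1).integrable_convolution _ (hu p.2)
  have hW2 : ∀ p, MemLp (W p) 2 := fun p => by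
    obtain ⟨B, hB⟩ := hB p.2
    exact memLp_two_of_integrable_of_bounded (hW1 p) (norm_convolution_le (hu p.1) hB)
  have hWF : ∀ p x, 𝓕⁻ (W p) x = 𝓕⁻ (u p.1) x * 𝓕⁻ (u p.2) x := fun p x =>
    fourierInv_mul_convolution_eq (hu p.1) (hu p.2) x
  have hmem : ∀ p, MemLp (𝓕⁻ (W p)) 2 := fun p => memLp_two_fourierInv (hW1 p) (hW2 p)
  have key := norm_sum_sq_le_of_almost_orthogonal (M ×ˢ M) (fun p => (hmem p).toLp (𝓕⁻ (W p)))
    R hsymm K hK (fun p hp q hq hpq => by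
      rw [inner_toLp_fourierInv_eq (hW1 p) (hW2 p) (hW1 q) (hW2 q)]
      refine inner_toLp_eq_zero_of_mul_eq_zero _ _ fun ζ => ?_
      by_contra! hc
      obtain ⟨ξ, η, h1, h2, h3⟩ := exists_of_convolution_ne_zero hc.1
      obtain ⟨ξ', η', h1', h2', h3'⟩ := exists_of_convolution_ne_zero hc.2
      exact hpq (hR p hp q hq ξ η ξ' η' h1 h2 h1' h2' (h3.trans h3'.symm)))
  have hnorm : ∀ (v : E → ℂ) (hv : MemLp v 2), ‖hv.toLp v‖ ^ 2 = ∫ x, ‖v x‖ ^ 2 := by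
    intro v hv
    rw [← inner_self_eq_norm_sq (𝕜 := ℂ), L2.inner_def, ← integral_re (L2.integrable_inner _ _)]
    refine integral_congr_ae ?_
    filter_upwards [hv.coeFn_toLp] with x hx
    rw [hx, inner_self_eq_norm_sq]
  have hsum : ∑ p ∈ M ×ˢ M, (hmem p).toLp (𝓕⁻ (W p))
      = (memLp_finsetSum' (M ×ˢ M) fun p _ => hmem p).toLp (∑ p ∈ M ×ˢ M, 𝓕⁻ (W p)) := by
    classical
    induction M ×ˢ M using Finset.induction_on with
    | empty => exact (MemLp.toLp_zero _).symm
    | insert p P hp ih =>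
      simp only [Finset.sum_insert hp]
      rw [ih]
      exact (MemLp.toLp_add _ _).symm
  rw [hsum, hnorm] at key
  simp only [hnorm] at key
  rw [← integral_finsetSum _ fun p _ => (memLp_two_iff_integrable_sq_norm (hmem p).1).1 (hmem p)]
    at key
  convert key using 2
  · congr 1 with x
    simp only [Finset.sum_apply, hWF, Finset.sum_product]
    rw [← Finset.sum_mul_sum, norm_mul]
    ring
  · congr 1 with x
    simp only [hWF, Finset.sum_product, norm_mul, mul_pow]
    rw [← Finset.sum_mul_sum, sq]

theorem memLp_four_fourierInv {u : E → ℂ} (hu : Integrable u) {B : ℝ} (hB : ∀ ξ, ‖u ξ‖ ≤ B) :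
    MemLp (𝓕⁻ u) 4 := by
  have h2 := memLp_two_fourierInv hu (memLp_two_of_integrable_of_bounded hu hB)
  have hcont := continuous_fourierInv_of_integrable hu
  refine (integrable_norm_rpow_iff hcont.aestronglyMeasurable (by norm_num) (by norm_num)).1 ?_
  have hb : ∀ x, ‖𝓕⁻ u x‖ ≤ ∫ ξ, ‖u ξ‖ := fun x =>
    VectorFourier.norm_fourierIntegral_le_integral_norm _ _ _ _ _
  have h : Integrable fun x => ‖𝓕⁻ u x‖ ^ 2 * ‖𝓕⁻ u x‖ ^ 2 :=
    ((memLp_two_iff_integrable_sq_norm h2.1).1 h2).bdd_mul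
      (hcont.norm.pow 2).aestronglyMeasurable (c := (∫ ξ, ‖u ξ‖) ^ 2)
      (.of_forall fun x => by
        rw [Real.norm_of_nonneg (by positivity)]
        gcongr
        exact hb x)
  refine h.congr (.of_forall fun x => ?_)
  simp only [ENNReal.toReal_ofNat]
  norm_cast
  ring

theorem eLpNorm_four_le_of_integral_le {α F G : Type*} [MeasurableSpace α] {μ : Measure α}
    [NormedAddCommGroup F] [NormedAddCommGroup G] {f : α → F} {g : α → G} (hf : MemLp f 4 μ)
    (hg : MemLp g 4 μ) {C : ℝ} (hC : 0 ≤ C)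
    (h : ∫ x, ‖f x‖ ^ 4 ∂μ ≤ C ^ 4 * ∫ x, ‖g x‖ ^ 4 ∂μ) :
    eLpNorm f 4 μ ≤ ENNReal.ofReal C * eLpNorm g 4 μ := by
  rw [hf.eLpNorm_eq_integral_rpow_norm (by norm_num) (by norm_num),
    hg.eLpNorm_eq_integral_rpow_norm (by norm_num) (by norm_num), ← ENNReal.ofReal_mul hC]
  refine ENNReal.ofReal_le_ofReal ?_
  simp only [ENNReal.toReal_ofNat, Real.rpow_ofNat]
  calc _ ≤ (C ^ 4 * ∫ x, ‖g x‖ ^ 4 ∂μ) ^ (4 : ℝ)⁻¹ := by gcongr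
    _ = _ := by
      rw [Real.mul_rpow (by positivity) (by positivity)]
      congr 1
      exact Real.pow_rpow_inv_natCast hC (n := 4) (by norm_num)
end

theorem measurable_argTwoPi : Measurable argTwoPi := by
  have h : Measurable fun ξ : EuclideanSpace ℝ (Fin 2) =>
      Complex.arg (((ξ 0 : ℝ) : ℂ) + (ξ 1 : ℝ) * Complex.I) := by fun_prop
  exact Measurable.ite (measurableSet_lt h measurable_const) (h.add_const _) h

theorem measurableSet_circleSector (δ : ℝ) (N m : ℕ) : MeasurableSet (circleSector δ N m) := by
  refine (measurableSet_le measurable_const measurable_norm).inter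
    ((measurableSet_le measurable_norm measurable_const).inter
      ((measurableSet_le measurable_const measurable_argTwoPi).inter
        (measurableSet_lt measurable_argTwoPi measurable_const)))

/-- The identification of `ℝ²` with `ℂ`. -/
def planeToComplex (ξ : EuclideanSpace ℝ (Fin 2)) : ℂ := (ξ 0 : ℝ) + (ξ 1 : ℝ) * Complex.I

theorem planeToComplex_add (ξ η : EuclideanSpace ℝ (Fin 2)) :
    planeToComplex (ξ + η) = planeToComplex ξ + planeToComplex η := by
  simp only [planeToComplex, PiLp.add_apply]
  push_cast
  ring

theorem norm_planeToComplex (ξ : EuclideanSpace ℝ (Fin 2)) : ‖planeToComplex ξ‖ = ‖ξ‖ := by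
  rw [planeToComplex, Complex.norm_add_mul_I, EuclideanSpace.norm_eq]
  simp [Fin.sum_univ_two]

theorem planeToComplex_eq_polar (ξ : EuclideanSpace ℝ (Fin 2)) :
    planeToComplex ξ = ‖ξ‖ * Complex.exp (argTwoPi ξ * Complex.I) := by
  have h := Complex.norm_mul_exp_arg_mul_I (planeToComplex ξ)
  rw [norm_planeToComplex] at h
  conv_lhs => rw [← h]
  have h2 : argTwoPi ξ = if (planeToComplex ξ).arg < 0 then (planeToComplex ξ).arg + 2 * Real.pi
    else (planeToComplex ξ).arg := rfl
  rw [h2]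
  split_ifs
  · push_cast
    rw [add_mul, Complex.exp_add, Complex.exp_two_pi_mul_I, mul_one]
  · rfl

theorem norm_polar_add_sq (r s a b : ℝ) :
    ‖(r * Complex.exp (a * Complex.I) + s * Complex.exp (b * Complex.I) : ℂ)‖ ^ 2
      = r ^ 2 + s ^ 2 + 2 * r * s * Real.cos (a - b) := by
  rw [← Complex.normSq_eq_norm_sq, Complex.normSq_apply, Complex.exp_mul_I, Complex.exp_mul_I,
    Real.cos_sub]
  simp only [Complex.add_re, Complex.add_im, Complex.mul_re, Complex.mul_im, Complex.ofReal_re,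
    Complex.ofReal_im, Complex.I_re, Complex.I_im, ← Complex.ofReal_cos, ← Complex.ofReal_sin]
  linear_combination r ^ 2 * Real.sin_sq_add_cos_sq a + s ^ 2 * Real.sin_sq_add_cos_sq b

theorem one_le_norm_polar_add {r s a b : ℝ} (hr : 3 / 4 ≤ r) (hs : 3 / 4 ≤ s)
    (hab : |a - b| ≤ Real.pi / 2) :
    1 ≤ ‖(r * Complex.exp (a * Complex.I) + s * Complex.exp (b * Complex.I) : ℂ)‖ := by
  have hc : 0 ≤ Real.cos (a - b) :=
    Real.cos_nonneg_of_mem_Icc ⟨(abs_le.1 hab).1, (abs_le.1 hab).2⟩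
  have h := norm_polar_add_sq r s a b
  have : 0 ≤ 2 * r * s * Real.cos (a - b) := by positivity
  rw [← abs_of_nonneg (norm_nonneg _), ← one_le_sq_iff_one_le_abs, h]
  nlinarith

theorem abs_angle_sub_le_norm_polar_sub {r s a b : ℝ} (hr : 3 / 4 ≤ r)
    (hab : |a - b| ≤ Real.pi / 2) :
    3 / 4 * (2 / Real.pi * |a - b|) ≤
      ‖(r * Complex.exp (a * Complex.I) - s * Complex.exp (b * Complex.I) : ℂ)‖ := by
  have h := norm_polar_add_sq r (-s) a b
  have hsin := Real.mul_le_sin (abs_nonneg _) hab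
  have h0 : 0 ≤ 2 / Real.pi * |a - b| := by positivity
  have hsq : Real.sin |a - b| ^ 2 = Real.sin (a - b) ^ 2 := by
    rcases abs_choice (a - b) with h | h <;> rw [h]
    rw [Real.sin_neg, neg_sq]
  have h1 : (3 / 4 * (2 / Real.pi * |a - b|)) ^ 2 ≤ (r * Real.sin |a - b|) ^ 2 := by
    gcongr
  refine le_of_sq_le_sq (h1.trans ?_) (norm_nonneg _)
  rw [Complex.ofReal_neg, neg_mul, ← sub_eq_add_neg] at h
  rw [h, mul_pow, hsq]
  nlinarith [sq_nonneg (s - r * Real.cos (a - b)), Real.sin_sq_add_cos_sq (a - b)]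

/-- If two pairs of almost unit complex numbers have the same sum, and this sum is not small, then
the pairs are close to each other up to order. -/
theorem norm_sub_mul_norm_sub_le {δ : ℝ} (hδ : δ ≤ 1 / 4) {z w z' w' : ℂ}
    (hz : |‖z‖ - 1| ≤ δ) (hw : |‖w‖ - 1| ≤ δ) (hz' : |‖z'‖ - 1| ≤ δ) (hw' : |‖w'‖ - 1| ≤ δ)
    (hsum : z + w = z' + w') (hs : 1 ≤ ‖z + w‖) : ‖z - z'‖ * ‖z - w'‖ ≤ 12 * δ := by
  have key : ∀ p q : ℂ, |‖p‖ - 1| ≤ δ → |‖q‖ - 1| ≤ δ →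
      ‖p * q * (starRingEnd ℂ) (p + q) - (p + q)‖ ≤ 6 * δ := by
    intro p q hp hq
    have e : p * q * (starRingEnd ℂ) (p + q) - (p + q)
        = ((‖p‖ ^ 2 - 1 : ℝ) : ℂ) * q + ((‖q‖ ^ 2 - 1 : ℝ) : ℂ) * p := by
      have h1 := Complex.mul_conj' p
      have h2 := Complex.mul_conj' q
      rw [map_add]
      push_cast
      linear_combination q * h1 + p * h2
    have hb : ∀ x : ℂ, |‖x‖ - 1| ≤ δ → |‖x‖ ^ 2 - 1| ≤ 9 / 4 * δ ∧ ‖x‖ ≤ 5 / 4 := by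
      intro x hx
      have hx2 := abs_le.1 hx
      refine ⟨?_, by linarith⟩
      rw [show ‖x‖ ^ 2 - 1 = (‖x‖ + 1) * (‖x‖ - 1) by ring, abs_mul]
      have : |‖x‖ + 1| ≤ 9 / 4 := by rw [abs_of_nonneg (by positivity)]; linarith
      gcongr
    have hδ0 : 0 ≤ δ := (abs_nonneg _).trans hp
    rw [e]
    refine (norm_add_le _ _).trans ?_
    rw [norm_mul, norm_mul, Complex.norm_real, Complex.norm_real, Real.norm_eq_abs,
      Real.norm_eq_abs]
    have h1 : |‖p‖ ^ 2 - 1| * ‖q‖ ≤ 9 / 4 * δ * (5 / 4) :=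
      mul_le_mul (hb p hp).1 (hb q hq).2 (norm_nonneg _) (by positivity)
    have h2 : |‖q‖ ^ 2 - 1| * ‖p‖ ≤ 9 / 4 * δ * (5 / 4) :=
      mul_le_mul (hb q hq).1 (hb p hp).2 (norm_nonneg _) (by positivity)
    linarith
  have k1 := key z w hz hw
  have k2 := key z' w' hz' hw'
  rw [← hsum] at k2
  have e : (z - z') * (z - w') * (starRingEnd ℂ) (z + w)
      = (z' * w' * (starRingEnd ℂ) (z + w) - (z + w))
        - (z * w * (starRingEnd ℂ) (z + w) - (z + w)) := by
    linear_combination (z * (starRingEnd ℂ) (z + w)) * hsum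
  calc ‖z - z'‖ * ‖z - w'‖ ≤ ‖z - z'‖ * ‖z - w'‖ * ‖z + w‖ :=
        le_mul_of_one_le_right (by positivity) hs
    _ = ‖(z - z') * (z - w') * (starRingEnd ℂ) (z + w)‖ := by
        rw [norm_mul, norm_mul, RCLike.norm_conj]
    _ ≤ 12 * δ := by
        rw [e]
        exact (norm_sub_le _ _).trans (by linarith)

theorem argTwoPi_mem_of_mem_circleSector {δ : ℝ} (hδ0 : 0 < δ) (hδ : δ ≤ 1 / 4) {m j : ℕ}
    (hm : 8 * m / ⌈2 * Real.pi / Real.sqrt δ⌉₊ = j) {ξ : EuclideanSpace ℝ (Fin 2)}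
    (hξ : ξ ∈ circleSector δ ⌈2 * Real.pi / Real.sqrt δ⌉₊ m) :
    Real.pi * j / 4 ≤ argTwoPi ξ ∧ argTwoPi ξ ≤ Real.pi * j / 4 + Real.pi / 2 := by
  have hπ := Real.pi_gt_three
  have hs0 : 0 < Real.sqrt δ := Real.sqrt_pos.2 hδ0
  have hs : Real.sqrt δ ≤ 1 / 2 := Real.sqrt_le_iff.2 ⟨by norm_num, by linarith⟩
  have hN : 2 * Real.pi / Real.sqrt δ ≤ ⌈2 * Real.pi / Real.sqrt δ⌉₊ := Nat.le_ceil _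
  set N := ⌈2 * Real.pi / Real.sqrt δ⌉₊
  rw [div_le_iff₀ hs0] at hN
  have hN0 : (0 : ℝ) < N := by
    by_contra h
    nlinarith
  have hN' : 0 < N := by exact_mod_cast hN0
  obtain ⟨-, -, h1, h2⟩ := hξ
  have h3 : j * N ≤ 8 * m := hm ▸ Nat.div_mul_le_self _ _
  have h4 : 8 * m < (j + 1) * N := by
    rw [← hm, mul_comm (_ + 1)]
    exact Nat.lt_mul_div_succ _ hN'
  have h3' : (j : ℝ) * N ≤ 8 * m := by exact_mod_cast h3
  have h4' : (8 : ℝ) * m ≤ (j + 1) * N := by exact_mod_cast h4.le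
  constructor
  · refine le_trans ?_ h1
    rw [div_le_div_iff₀ (by norm_num) hN0]
    nlinarith
  · refine h2.le.trans ?_
    rw [div_le_iff₀ hN0]
    nlinarith

theorem index_le_of_angle_le {δ : ℝ} (hδ0 : 0 < δ) (hδ : δ ≤ 1 / 4) {m m' : ℕ}
    {ξ ξ' : EuclideanSpace ℝ (Fin 2)}
    (hξ : ξ ∈ circleSector δ ⌈2 * Real.pi / Real.sqrt δ⌉₊ m)
    (hξ' : ξ' ∈ circleSector δ ⌈2 * Real.pi / Real.sqrt δ⌉₊ m')
    (h : argTwoPi ξ - argTwoPi ξ' ≤ 7.35 * Real.sqrt δ) : m ≤ m' + 8 := by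
  have hπ := Real.pi_gt_three
  have hs0 : 0 < Real.sqrt δ := Real.sqrt_pos.2 hδ0
  have hs : Real.sqrt δ ≤ 1 / 2 := Real.sqrt_le_iff.2 ⟨by norm_num, by linarith⟩
  have hN : 2 * Real.pi / Real.sqrt δ ≤ ⌈2 * Real.pi / Real.sqrt δ⌉₊ := Nat.le_ceil _
  have hN2 : (⌈2 * Real.pi / Real.sqrt δ⌉₊ : ℝ) < 2 * Real.pi / Real.sqrt δ + 1 :=
    Nat.ceil_lt_add_one (by positivity)
  set N := ⌈2 * Real.pi / Real.sqrt δ⌉₊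
  have hN0 : (0 : ℝ) < N := lt_of_lt_of_le (by positivity) hN
  have hsN : Real.sqrt δ * N ≤ 2 * Real.pi + 1 / 2 := by
    calc Real.sqrt δ * N ≤ Real.sqrt δ * (2 * Real.pi / Real.sqrt δ + 1) := by gcongr
      _ = 2 * Real.pi + Real.sqrt δ := by field_simp
      _ ≤ _ := by linarith
  have h1 : 2 * Real.pi * m / N - 2 * Real.pi * (m' + 1) / N < 7.35 * Real.sqrt δ := by
    linarith [hξ.2.2.1, hξ'.2.2.2]
  rw [← sub_div, div_lt_iff₀ hN0] at h1
  have h2 : (m : ℝ) < m' + 9 := by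
    by_contra! hc
    nlinarith
  have : m < m' + 9 := by exact_mod_cast h2
  omega

theorem index_close_of_norm_le {δ : ℝ} (hδ0 : 0 < δ) (hδ : δ ≤ 1 / 4) {m m' j : ℕ}
    (hm : 8 * m / ⌈2 * Real.pi / Real.sqrt δ⌉₊ = j)
    (hm' : 8 * m' / ⌈2 * Real.pi / Real.sqrt δ⌉₊ = j)
    {ξ ξ' : EuclideanSpace ℝ (Fin 2)}
    (hξ : ξ ∈ circleSector δ ⌈2 * Real.pi / Real.sqrt δ⌉₊ m)
    (hξ' : ξ' ∈ circleSector δ ⌈2 * Real.pi / Real.sqrt δ⌉₊ m')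
    (h : ‖planeToComplex ξ - planeToComplex ξ'‖ ≤ 3.5 * Real.sqrt δ) :
    m' ∈ Finset.Icc (m - 8) (m + 8) := by
  have a1 := argTwoPi_mem_of_mem_circleSector hδ0 hδ hm hξ
  have a2 := argTwoPi_mem_of_mem_circleSector hδ0 hδ hm' hξ'
  have hs0 : 0 < Real.sqrt δ := Real.sqrt_pos.2 hδ0
  have hπ := Real.pi_pos
  have hπ' := Real.pi_lt_d2
  have hab : |argTwoPi ξ - argTwoPi ξ'| ≤ Real.pi / 2 := abs_le.2 ⟨by linarith, by linarith⟩
  rw [planeToComplex_eq_polar, planeToComplex_eq_polar] at h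
  have h1 := (abs_angle_sub_le_norm_polar_sub (by linarith [hξ.1]) hab).trans h
  have h2 : |argTwoPi ξ - argTwoPi ξ'| ≤ 7.35 * Real.sqrt δ := by
    have e : 3 / 4 * (2 / Real.pi * |argTwoPi ξ - argTwoPi ξ'|)
        = 3 / 2 * |argTwoPi ξ - argTwoPi ξ'| / Real.pi := by ring
    rw [e, div_le_iff₀ hπ] at h1
    nlinarith
  have h3 := index_le_of_angle_le hδ0 hδ hξ hξ' (abs_le.1 h2).2
  have h4 := index_le_of_angle_le hδ0 hδ hξ' hξ (by linarith [(abs_le.1 h2).1])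
  rw [Finset.mem_Icc]
  omega

theorem index_pair_close_of_add_eq {δ : ℝ} (hδ0 : 0 < δ) (hδ : δ ≤ 1 / 4) {m n m' n' j : ℕ}
    (hm : 8 * m / ⌈2 * Real.pi / Real.sqrt δ⌉₊ = j)
    (hn : 8 * n / ⌈2 * Real.pi / Real.sqrt δ⌉₊ = j)
    (hm' : 8 * m' / ⌈2 * Real.pi / Real.sqrt δ⌉₊ = j)
    (hn' : 8 * n' / ⌈2 * Real.pi / Real.sqrt δ⌉₊ = j)
    {ξ η ξ' η' : EuclideanSpace ℝ (Fin 2)}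
    (hξ : ξ ∈ circleSector δ ⌈2 * Real.pi / Real.sqrt δ⌉₊ m)
    (hη : η ∈ circleSector δ ⌈2 * Real.pi / Real.sqrt δ⌉₊ n)
    (hξ' : ξ' ∈ circleSector δ ⌈2 * Real.pi / Real.sqrt δ⌉₊ m')
    (hη' : η' ∈ circleSector δ ⌈2 * Real.pi / Real.sqrt δ⌉₊ n')
    (h : ξ + η = ξ' + η') :
    (m' ∈ Finset.Icc (m - 8) (m + 8) ∧ n' ∈ Finset.Icc (n - 8) (n + 8)) ∨
      (m' ∈ Finset.Icc (n - 8) (n + 8) ∧ n' ∈ Finset.Icc (m - 8) (m + 8)) := by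
  have hnorm : ∀ {k : ℕ} {ζ : EuclideanSpace ℝ (Fin 2)},
      ζ ∈ circleSector δ ⌈2 * Real.pi / Real.sqrt δ⌉₊ k → |‖planeToComplex ζ‖ - 1| ≤ δ := by
    intro k ζ hζ
    rw [norm_planeToComplex]
    exact abs_le.2 ⟨by linarith [hζ.1], by linarith [hζ.2.1]⟩
  have hsum : planeToComplex ξ + planeToComplex η = planeToComplex ξ' + planeToComplex η' := by
    rw [← planeToComplex_add, ← planeToComplex_add, h]
  have a1 := argTwoPi_mem_of_mem_circleSector hδ0 hδ hm hξ
  have a2 := argTwoPi_mem_of_mem_circleSector hδ0 hδ hn hη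
  have hs : 1 ≤ ‖planeToComplex ξ + planeToComplex η‖ := by
    rw [planeToComplex_eq_polar, planeToComplex_eq_polar]
    exact one_le_norm_polar_add (by linarith [hξ.1]) (by linarith [hη.1])
      (abs_le.2 ⟨by linarith, by linarith⟩)
  have hprod := norm_sub_mul_norm_sub_le hδ (hnorm hξ) (hnorm hη) (hnorm hξ') (hnorm hη') hsum hs
  have hs0 : 0 < Real.sqrt δ := Real.sqrt_pos.2 hδ0
  have hsq := Real.sq_sqrt hδ0.le
  by_cases hc : ‖planeToComplex ξ - planeToComplex ξ'‖ ≤ 3.5 * Real.sqrt δ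
  · refine Or.inl ⟨index_close_of_norm_le hδ0 hδ hm hm' hξ hξ' hc,
      index_close_of_norm_le hδ0 hδ hn hn' hη hη' ?_⟩
    rwa [show planeToComplex η - planeToComplex η' = -(planeToComplex ξ - planeToComplex ξ') by
      linear_combination hsum, norm_neg]
  · have hc2 : ‖planeToComplex ξ - planeToComplex η'‖ ≤ 3.5 * Real.sqrt δ := by
      by_contra! hd
      push Not at hc
      have := mul_lt_mul'' hc hd (by positivity) (by positivity)
      nlinarith
    refine Or.inr ⟨index_close_of_norm_le hδ0 hδ hn hm' hη hξ' ?_,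
      index_close_of_norm_le hδ0 hδ hm hn' hξ hη' hc2⟩
    rwa [show planeToComplex η - planeToComplex ξ' = -(planeToComplex ξ - planeToComplex η') by
      linear_combination hsum, norm_neg]

open Classical in
/-- The reverse square function estimate for the sectors contained in a fixed half-quadrant. -/
theorem eLpNorm_sum_fourierInv_sector_le {δ : ℝ} (hδ0 : 0 < δ) (hδ : δ ≤ 1 / 4) (j : ℕ)
    (M : Finset ℕ) (hM : ∀ m ∈ M, 8 * m / ⌈2 * Real.pi / Real.sqrt δ⌉₊ = j)
    (u : ℕ → EuclideanSpace ℝ (Fin 2) → ℂ) (hu : ∀ m, Integrable (u m))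
    (hB : ∀ m, ∃ B, ∀ ξ, ‖u m ξ‖ ≤ B)
    (hsupp : ∀ m ξ, u m ξ ≠ 0 → ξ ∈ circleSector δ ⌈2 * Real.pi / Real.sqrt δ⌉₊ m) :
    eLpNorm (fun x => ∑ m ∈ M, 𝓕⁻ (u m) x) 4 volume ≤ ENNReal.ofReal 5 *
      eLpNorm (fun x => Real.sqrt (∑ m ∈ M, ‖𝓕⁻ (u m) x‖ ^ 2)) 4 volume := by
  have hmem : ∀ m, MemLp (𝓕⁻ (u m)) 4 := fun m =>
    (hB m).elim fun _ h => memLp_four_fourierInv (hu m) h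
  have hcont : ∀ m, Continuous (𝓕⁻ (u m)) := fun m => continuous_fourierInv_of_integrable (hu m)
  have hS : MemLp (fun x => Real.sqrt (∑ m ∈ M, ‖𝓕⁻ (u m) x‖ ^ 2)) 4 volume := by
    refine (memLp_finsetSum M fun m _ => (hmem m).norm).mono'
      (by fun_prop) (.of_forall fun x => ?_)
    rw [Real.norm_of_nonneg (Real.sqrt_nonneg _)]
    refine Real.sqrt_le_iff.2 ⟨by positivity, ?_⟩
    exact Finset.sum_sq_le_sq_sum_of_nonneg fun m _ => norm_nonneg _
  have hF : MemLp (fun x => ∑ m ∈ M, 𝓕⁻ (u m) x) 4 volume := memLp_finsetSum M fun m _ => hmem m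
  have h5 : (0 : ℝ) ≤ 5 := by norm_num
  refine eLpNorm_four_le_of_integral_le hF hS h5 ?_
  obtain ⟨near, hnear_def⟩ : ∃ near : ℕ → Finset ℕ, near = fun m => Finset.Icc (m - 8) (m + 8) :=
    ⟨_, rfl⟩
  have hnear : ∀ m, (near m).card ≤ 17 := fun m => by
    simp only [hnear_def, Nat.card_Icc]
    omega
  have hnear_symm : ∀ m n, n ∈ near m ↔ m ∈ near n := fun m n => by
    simp only [hnear_def, Finset.mem_Icc]
    omega
  let R : ℕ × ℕ → ℕ × ℕ → Prop := fun p q =>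
    q ∈ near p.1 ×ˢ near p.2 ∪ near p.2 ×ˢ near p.1
  have hcard : ∀ p ∈ M ×ˢ M, ((M ×ˢ M).filter (R p)).card ≤ 625 := fun p _ => by
    calc _ ≤ (near p.1 ×ˢ near p.2 ∪ near p.2 ×ˢ near p.1).card :=
          Finset.card_le_card fun q hq => (Finset.mem_filter.1 hq).2
      _ ≤ (near p.1 ×ˢ near p.2).card + (near p.2 ×ˢ near p.1).card := Finset.card_union_le _ _
      _ ≤ 17 * 17 + 17 * 17 := by
          rw [Finset.card_product, Finset.card_product]
          gcongr <;> exact hnear _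
      _ ≤ 625 := by norm_num
  have key := integral_norm_sum_fourierInv_pow_four_le M u hu hB R
    (fun p q h => by
      simp only [R, Finset.mem_union, Finset.mem_product] at h ⊢
      rw [hnear_symm q.1, hnear_symm q.2, hnear_symm q.1, hnear_symm q.2]
      tauto)
    (fun p hp q hq ξ η ξ' η' h1 h2 h3 h4 h => by
      rw [Finset.mem_product] at hp hq
      simp only [R, Finset.mem_union, Finset.mem_product, hnear_def]
      exact index_pair_close_of_add_eq hδ0 hδ (hM _ hp.1) (hM _ hp.2) (hM _ hq.1) (hM _ hq.2)
        (hsupp _ _ h1) (hsupp _ _ h2) (hsupp _ _ h3) (hsupp _ _ h4) h)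
    625 hcard
  refine key.trans_eq ?_
  congr 1
  · norm_num
  congr 1 with x
  rw [Real.norm_of_nonneg (Real.sqrt_nonneg _), show 4 = 2 * 2 from rfl, pow_mul,
    Real.sq_sqrt (by positivity)]

theorem eLpNorm_sum_le_sqrt_card_mul {α : Type*} [MeasurableSpace α] {μ : Measure α} {p : ENNReal}
    (M : Finset ℕ) (g : ℕ → α → ℂ) {C : ℝ} (hC : 0 ≤ C) (hM : (M.card : ℝ) ≤ C ^ 2) :
    eLpNorm (fun x => ∑ m ∈ M, g m x) p μ ≤ ENNReal.ofReal C *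
      eLpNorm (fun x => Real.sqrt (∑ m ∈ M, ‖g m x‖ ^ 2)) p μ := by
  refine eLpNorm_le_mul_eLpNorm_of_ae_le_mul (.of_forall fun x => ?_) _
  rw [Real.norm_of_nonneg (Real.sqrt_nonneg _)]
  refine (norm_sum_le _ _).trans ?_
  rw [← Real.sqrt_sq hC, ← Real.sqrt_mul (sq_nonneg C)]
  refine Real.le_sqrt_of_sq_le (sq_sum_le_card_mul_sum_sq.trans ?_)
  gcongr

theorem eLpNorm_sum_fourierInv_circleSector_le {δ : ℝ} (hδ0 : 0 < δ) (hδ : δ ≤ 1 / 4)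
    (u : ℕ → EuclideanSpace ℝ (Fin 2) → ℂ) (hu : ∀ m, Integrable (u m))
    (hB : ∀ m, ∃ B, ∀ ξ, ‖u m ξ‖ ≤ B)
    (hsupp : ∀ m ξ, u m ξ ≠ 0 → ξ ∈ circleSector δ ⌈2 * Real.pi / Real.sqrt δ⌉₊ m) :
    eLpNorm (fun x => ∑ m ∈ Finset.range ⌈2 * Real.pi / Real.sqrt δ⌉₊, 𝓕⁻ (u m) x) 4 volume ≤
      ENNReal.ofReal 40 * eLpNorm (fun x => Real.sqrt
        (∑ m ∈ Finset.range ⌈2 * Real.pi / Real.sqrt δ⌉₊, ‖𝓕⁻ (u m) x‖ ^ 2)) 4 volume := by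
  set N := ⌈2 * Real.pi / Real.sqrt δ⌉₊
  set A : ℕ → Finset ℕ := fun j => (Finset.range N).filter fun m => 8 * m / N = j
  have hsplit : (fun x => ∑ m ∈ Finset.range N, 𝓕⁻ (u m) x)
      = ∑ j ∈ Finset.range 8, fun x => ∑ m ∈ A j, 𝓕⁻ (u m) x := by
    ext x
    rw [Finset.sum_apply]
    refine (Finset.sum_fiberwise_of_maps_to (fun m hm => ?_) _).symm
    rw [Finset.mem_range] at hm ⊢
    rw [Nat.div_lt_iff_lt_mul (by omega)]
    omega
  have hcont : ∀ m, Continuous (𝓕⁻ (u m)) := fun m => continuous_fourierInv_of_integrable (hu m)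
  rw [hsplit]
  refine (eLpNorm_sum_le (fun j _ => Continuous.aestronglyMeasurable (by fun_prop))
    (by norm_num)).trans ?_
  have hj : ∀ j ∈ Finset.range 8, eLpNorm (fun x => ∑ m ∈ A j, 𝓕⁻ (u m) x) 4 volume ≤
      ENNReal.ofReal 5 * eLpNorm (fun x => Real.sqrt
        (∑ m ∈ Finset.range N, ‖𝓕⁻ (u m) x‖ ^ 2)) 4 volume := by
    intro j _
    refine (eLpNorm_sum_fourierInv_sector_le hδ0 hδ j (A j)
      (fun m hm => (Finset.mem_filter.1 hm).2) u hu hB hsupp).trans ?_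
    gcongr
    refine eLpNorm_mono_real fun x => ?_
    rw [Real.norm_of_nonneg (Real.sqrt_nonneg _)]
    refine Real.sqrt_le_sqrt ?_
    exact Finset.sum_le_sum_of_subset_of_nonneg (Finset.filter_subset _ _)
      fun _ _ _ => by positivity
  refine (Finset.sum_le_sum hj).trans_eq ?_
  rw [Finset.sum_const, Finset.card_range, nsmul_eq_mul, ← mul_assoc]
  congr 1
  rw [show (40 : ℝ) = (8 : ℕ) * 5 by norm_num, ENNReal.ofReal_mul (by positivity),
    ENNReal.ofReal_natCast]

theorem fefferman_reverse_square_function :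
    ∃ C : ℝ, 0 < C ∧
      ∀ δ : ℝ, 0 < δ → δ ≤ 1 →
        ∀ f : SchwartzMap (EuclideanSpace ℝ (Fin 2)) ℂ,
          eLpNorm
              (fun x => ∑ m ∈ Finset.range ⌈2 * Real.pi / Real.sqrt δ⌉₊,
                freqProj2 (circleSector δ ⌈2 * Real.pi / Real.sqrt δ⌉₊ m) (⇑f) x)
              4 volume ≤
            ENNReal.ofReal C *
              eLpNorm
                (fun x => Real.sqrt
                  (∑ m ∈ Finset.range ⌈2 * Real.pi / Real.sqrt δ⌉₊,
                    ‖freqProj2 (circleSector δ ⌈2 * Real.pi / Real.sqrt δ⌉₊ m) (⇑f) x‖ ^ 2))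
                4 volume := by
  refine ⟨40, by norm_num, fun δ hδ0 hδ1 f => ?_⟩
  by_cases hδ : δ ≤ 1 / 4
  · have hint : Integrable (𝓕 (f : EuclideanSpace ℝ (Fin 2) → ℂ)) := by
      rw [← SchwartzMap.fourier_coe]
      exact (𝓕 f).integrable
    obtain ⟨B, hB⟩ : ∃ B, ∀ ξ, ‖𝓕 (f : EuclideanSpace ℝ (Fin 2) → ℂ) ξ‖ ≤ B :=
      ⟨_, VectorFourier.norm_fourierIntegral_le_integral_norm _ _ _ _⟩
    refine eLpNorm_sum_fourierInv_circleSector_le hδ0 hδ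
      (fun m => (circleSector δ _ m).indicator (𝓕 (f : EuclideanSpace ℝ (Fin 2) → ℂ)))
      (fun m => hint.indicator (measurableSet_circleSector _ _ _))
      (fun m => ⟨B, fun ξ => (norm_indicator_le_norm_self _ _).trans (hB ξ)⟩)
      (fun m ξ h => Set.mem_of_indicator_ne_zero h)
  · refine eLpNorm_sum_le_sqrt_card_mul _ _ (by norm_num) ?_
    have hs : 1 / 2 ≤ Real.sqrt δ := Real.le_sqrt_of_sq_le (by linarith)
    have h : 2 * Real.pi / Real.sqrt δ ≤ 13 := by
      rw [div_le_iff₀ (by linarith)]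
      nlinarith [Real.pi_lt_d2]
    have hN : ⌈2 * Real.pi / Real.sqrt δ⌉₊ ≤ 13 := Nat.ceil_le.2 (by exact_mod_cast h)
    rw [Finset.card_range]
    calc (⌈2 * Real.pi / Real.sqrt δ⌉₊ : ℝ) ≤ 13 := by exact_mod_cast hN
      _ ≤ 40 ^ 2 := by norm_num
end
end
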